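/- arXiv:1512.01908 — 2 statements merged into one kernel-verified Lean document; each statement's English description precedes it below -/
import Mathlib

section
/- For every nonempty topological space X and every integer i ≥ 1, the (i+1)-st singular homology group (with integer coefficients) of the unreduced suspension of X is isomorphic to the i-th singular homology group of X: H_{i+1}(ΣX) ≅ H_i(X). -/
open CategoryTheory unitInterval

/-- The gluing relation for the unreduced suspension: collapse `X × {0}` to a point
and `X × {1}` to a point. -/
def suspSetoid (X : Type) [TopologicalSpace X] : Setoid (X × unitInterval) where
  r p q := p = q ∨ (p.2 = 0 ∧ q.2 = 0) ∨ (p.2 = 1 ∧ q.2 = 1)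
  iseqv := by
    refine ⟨fun _ => Or.inl rfl, ?_, ?_⟩
    · rintro p q (rfl | ⟨h1, h2⟩ | ⟨h1, h2⟩)
      exacts [Or.inl rfl, Or.inr (Or.inl ⟨h2, h1⟩), Or.inr (Or.inr ⟨h2, h1⟩)]
    · have zno : (0 : unitInterval) ≠ 1 := fun h => by
        simpa using congrArg Subtype.val h
      rintro p q r (rfl | ⟨h1, h2⟩ | ⟨h1, h2⟩) (rfl | ⟨g1, g2⟩ | ⟨g1, g2⟩)
      · exact Or.inl rfl
      · exact Or.inr (Or.inl ⟨g1, g2⟩)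
      · exact Or.inr (Or.inr ⟨g1, g2⟩)
      · exact Or.inr (Or.inl ⟨h1, h2⟩)
      · exact Or.inr (Or.inl ⟨h1, g2⟩)
      · exact absurd (h2.symm.trans g1) zno
      · exact Or.inr (Or.inr ⟨h1, h2⟩)
      · exact absurd (g1.symm.trans h2) zno
      · exact Or.inr (Or.inr ⟨h1, g2⟩)

/-- The unreduced suspension `ΣX` of a topological space `X`: the quotient of
`X × [0,1]` collapsing `X × {0}` to one point and `X × {1}` to another. -/
def UnreducedSuspension (X : Type) [TopologicalSpace X] : Type :=
  Quotient (suspSetoid X)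

instance (X : Type) [TopologicalSpace X] : TopologicalSpace (UnreducedSuspension X) :=
  instTopologicalSpaceQuotient

/-- The singular chain complex of a topological space, with `ℤ` coefficients. -/
noncomputable def singularChainComplex (X : Type) [TopologicalSpace X] :
    ChainComplex (ModuleCat ℤ) ℕ :=
  (AlgebraicTopology.alternatingFaceMapComplex (ModuleCat ℤ)).obj
    (((SimplicialObject.whiskering _ _).obj (ModuleCat.free ℤ)).obj
      (TopCat.toSSet.obj (TopCat.of X)))

/-- The `n`-th singular homology of a topological space, with `ℤ` coefficients. -/
noncomputable def singularHomology (X : Type) [TopologicalSpace X] (n : ℕ) : ModuleCat ℤ :=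
  (singularChainComplex X).homology n

namespace SuspAux
section
/-! ### Augmented ordered chains on a type -/

/-- free module on `k`-tuples. -/
abbrev L (W : Type) (k : ℕ) := (Fin k → W) →₀ ℤ

/-- boundary -/
noncomputable def bd (W : Type) (k : ℕ) : L W (k + 1) →ₗ[ℤ] L W k :=
  Finsupp.linearCombination ℤ
    (fun v => ∑ i : Fin (k + 1), (-1 : ℤ) ^ (i : ℕ) • Finsupp.single (fun j => v (i.succAbove j)) (1 : ℤ))

/-- cone -/
noncomputable def cone {W : Type} (b : W) (k : ℕ) : L W k →ₗ[ℤ] L W (k + 1) :=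
  Finsupp.linearCombination ℤ
    (fun v => Finsupp.single (Fin.cons b v : Fin (k + 1) → W) (1 : ℤ))

lemma bd_single {W : Type} {k : ℕ} (v : Fin (k + 1) → W) :
    bd W k (Finsupp.single v 1) =
      ∑ i : Fin (k + 1), (-1 : ℤ) ^ (i : ℕ) •
        Finsupp.single (fun j => v (i.succAbove j)) (1 : ℤ) := by
  simp [bd]

lemma cone_single {W : Type} (b : W) {k : ℕ} (v : Fin k → W) :
    cone b k (Finsupp.single v 1) = Finsupp.single (Fin.cons b v : Fin (k + 1) → W) (1 : ℤ) := by
  simp [cone]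

lemma bd_cone_zero {W : Type} (b : W) (x : L W 0) : bd W 0 (cone b 0 x) = x := by
  suffices h : (bd W 0).comp (cone b 0) = LinearMap.id from LinearMap.congr_fun h x
  ext v : 2
  simp only [LinearMap.comp_apply, Finsupp.lsingle_apply, cone_single, bd_single]
  simp

lemma bd_cone {W : Type} (b : W) (k : ℕ) (x : L W (k + 1)) :
    bd W (k + 1) (cone b (k + 1) x) = x - cone b k (bd W k x) := by
  suffices h : (bd W (k + 1)).comp (cone b (k + 1)) = LinearMap.id - (cone b k).comp (bd W k) from
    LinearMap.congr_fun h x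
  ext v : 2
  simp only [LinearMap.comp_apply, Finsupp.lsingle_apply, cone_single, bd_single,
    LinearMap.sub_apply, LinearMap.id_apply, map_sum, map_smul]
  rw [Fin.sum_univ_succ]
  simp only [Fin.val_zero, pow_zero, one_smul, Fin.zero_succAbove, Fin.cons_succ, Fin.val_succ,
    pow_succ, mul_neg, mul_one, neg_smul, Finset.sum_neg_distrib, ← sub_eq_add_neg]
  congr 1
  refine Finset.sum_congr rfl fun i _ => ?_
  congr 2
  funext j
  refine Fin.cases ?_ (fun j => ?_) j
  · simp
  · simp

lemma bd_bd {W : Type} (k : ℕ) (x : L W (k + 2)) : bd W k (bd W (k + 1) x) = 0 := by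
  suffices h : (bd W k).comp (bd W (k + 1)) = 0 from LinearMap.congr_fun h x
  ext v : 2
  simp only [LinearMap.comp_apply, Finsupp.lsingle_apply, LinearMap.zero_apply]
  rw [← Fin.cons_self_tail v, ← cone_single, bd_cone, map_sub]
  induction k with
  | zero => rw [bd_cone_zero, sub_self]
  | succ k ih =>
    rw [bd_cone]
    have : bd W k (bd W (k+1) (Finsupp.single (Fin.tail v) 1)) = 0 := by
      rw [← Fin.cons_self_tail (Fin.tail v), ← cone_single, bd_cone, map_sub]
      exact ih 0 _
    rw [this]; simp

/-- subdivision -/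
noncomputable def sd {W : Type} (b : ∀ k, (Fin (k + 1) → W) → W) : ∀ k, L W k →ₗ[ℤ] L W k
  | 0 => LinearMap.id
  | k + 1 => Finsupp.linearCombination ℤ
      (fun v => cone (b k v) k (sd b k (bd W k (Finsupp.single v 1))))

/-- homotopy -/
noncomputable def ht {W : Type} (b : ∀ k, (Fin (k + 1) → W) → W) : ∀ k, L W k →ₗ[ℤ] L W (k + 1)
  | 0 => 0
  | k + 1 => Finsupp.linearCombination ℤ
      (fun v => cone (b k v) (k + 1) (Finsupp.single v 1 - ht b k (bd W k (Finsupp.single v 1))))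

variable {W : Type} (b : ∀ k, (Fin (k + 1) → W) → W)

lemma sd_single (k : ℕ) (v : Fin (k + 1) → W) : sd b (k + 1) (Finsupp.single v 1) =
    cone (b k v) k (sd b k (bd W k (Finsupp.single v 1))) := by
  simp [sd]

lemma ht_single (k : ℕ) (v : Fin (k + 1) → W) : ht b (k + 1) (Finsupp.single v 1) =
    cone (b k v) (k + 1) (Finsupp.single v 1 - ht b k (bd W k (Finsupp.single v 1))) := by
  simp [ht]

lemma bd_sd (k : ℕ) (x : L W (k + 1)) : bd W k (sd b (k + 1) x) = sd b k (bd W k x) := by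
  induction k with
  | zero =>
    suffices h : (bd W 0).comp (sd b 1) = (sd b 0).comp (bd W 0) from LinearMap.congr_fun h x
    ext v : 2
    simp only [LinearMap.comp_apply, Finsupp.lsingle_apply, sd_single, bd_cone_zero]
  | succ k ih =>
    suffices h : (bd W (k+1)).comp (sd b (k+2)) = (sd b (k+1)).comp (bd W (k+1)) from
      LinearMap.congr_fun h x
    ext v : 2
    simp only [LinearMap.comp_apply, Finsupp.lsingle_apply]
    rw [sd_single, bd_cone, ih, bd_bd]
    simp

lemma bd_ht (k : ℕ) (x : L W (k + 1)) :
    bd W (k + 1) (ht b (k + 1) x) = x - sd b (k + 1) x - ht b k (bd W k x) := by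
  suffices h : (bd W (k+1)).comp (ht b (k+1)) =
      LinearMap.id - sd b (k+1) - (ht b k).comp (bd W k) from LinearMap.congr_fun h x
  induction k with
  | zero =>
    ext v : 2
    simp only [LinearMap.comp_apply, Finsupp.lsingle_apply, LinearMap.sub_apply, LinearMap.id_apply]
    rw [ht_single, bd_cone, sd_single]
    simp [ht, sd]
  | succ k ih =>
    ext v : 2
    simp only [LinearMap.comp_apply, Finsupp.lsingle_apply, LinearMap.sub_apply, LinearMap.id_apply]
    have ih' := LinearMap.congr_fun (ih 0) (bd W (k+1) (Finsupp.single v 1))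
    simp only [LinearMap.comp_apply, LinearMap.sub_apply, LinearMap.id_apply] at ih'
    rw [ht_single, bd_cone, sd_single, map_sub, ih', bd_bd]
    simp
    abel

/-- push forward of tuples -/
noncomputable def push {W W' : Type} (f : W → W') (k : ℕ) : L W k →ₗ[ℤ] L W' k :=
  Finsupp.linearCombination ℤ (fun v => Finsupp.single (fun i => f (v i)) (1 : ℤ))

lemma push_single {W W' : Type} (f : W → W') {k : ℕ} (v : Fin k → W) :
    push f k (Finsupp.single v 1) = Finsupp.single (fun i => f (v i)) (1 : ℤ) := by
  simp [push]

lemma push_cone {W W' : Type} (f : W → W') {k : ℕ} (c : W) (x : L W k) :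
    push f (k + 1) (cone c k x) = cone (f c) k (push f k x) := by
  suffices h : (push f (k+1)).comp (cone c k) = (cone (f c) k).comp (push f k) from
    LinearMap.congr_fun h x
  ext v : 2
  simp only [LinearMap.comp_apply, Finsupp.lsingle_apply, push_single, cone_single]
  congr 1
  funext j
  refine Fin.cases ?_ (fun j => ?_) j <;> simp

lemma push_bd {W W' : Type} (f : W → W') {k : ℕ} (x : L W (k + 1)) :
    push f k (bd W k x) = bd W' k (push f (k + 1) x) := by
  suffices h : (push f k).comp (bd W k) = (bd W' k).comp (push f (k+1)) from
    LinearMap.congr_fun h x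
  ext v : 2
  simp only [LinearMap.comp_apply, Finsupp.lsingle_apply, push_single, bd_single, map_sum, map_smul]

lemma push_sd {W W' : Type} (f : W → W') (b : ∀ k, (Fin (k + 1) → W) → W)
    (b' : ∀ k, (Fin (k + 1) → W') → W') (hf : ∀ k v, f (b k v) = b' k (fun i => f (v i)))
    (k : ℕ) (x : L W k) : push f k (sd b k x) = sd b' k (push f k x) := by
  induction k with
  | zero => rfl
  | succ k ih =>
    suffices h : (push f (k+1)).comp (sd b (k+1)) = (sd b' (k+1)).comp (push f (k+1)) from
      LinearMap.congr_fun h x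
    ext v : 2
    simp only [LinearMap.comp_apply, Finsupp.lsingle_apply, push_single]
    rw [sd_single, sd_single, push_cone, ih, push_bd, push_single, hf]

lemma push_ht {W W' : Type} (f : W → W') (b : ∀ k, (Fin (k + 1) → W) → W)
    (b' : ∀ k, (Fin (k + 1) → W') → W') (hf : ∀ k v, f (b k v) = b' k (fun i => f (v i)))
    (k : ℕ) (x : L W k) : push f (k + 1) (ht b k x) = ht b' k (push f k x) := by
  induction k with
  | zero => simp [ht]
  | succ k ih =>
    suffices h : (push f (k+2)).comp (ht b (k+1)) = (ht b' (k+1)).comp (push f (k+1)) from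
      LinearMap.congr_fun h x
    ext v : 2
    simp only [LinearMap.comp_apply, Finsupp.lsingle_apply, push_single]
    rw [ht_single, ht_single, push_cone, map_sub, ih, push_bd, push_single, hf]

lemma lc_mem {α M : Type*} [AddCommGroup M] (f : α → M) (s : Set α) (N : Submodule ℤ M)
    (h : ∀ a ∈ s, f a ∈ N) (x : α →₀ ℤ) (hx : x ∈ Finsupp.supported ℤ ℤ s) :
    Finsupp.linearCombination ℤ f x ∈ N := by
  rw [Finsupp.linearCombination_apply]
  refine N.sum_mem fun a ha => N.smul_mem _ (h a (hx ha))

lemma lin_mem {α M : Type*} [AddCommGroup M] (f : (α →₀ ℤ) →ₗ[ℤ] M) (s : Set α)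
    (N : Submodule ℤ M) (h : ∀ a ∈ s, f (Finsupp.single a 1) ∈ N) (x : α →₀ ℤ)
    (hx : x ∈ Finsupp.supported ℤ ℤ s) : f x ∈ N := by
  have : f = Finsupp.linearCombination ℤ (fun a => f (Finsupp.single a 1)) := by
    ext a; simp
  rw [this]
  exact lc_mem _ s N h x hx

end
end SuspAux

namespace SuspAux
section
/-- shorthand -/
abbrev D (k : ℕ) : Type := stdSimplex ℝ (Fin k)

/-- affine map with prescribed vertices -/
noncomputable def aff {k m : ℕ} (v : Fin k → D m) : C(D k, D m) where
  toFun t := ⟨fun j => ∑ i, t i * (v i) j, by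
    refine ⟨fun j => Finset.sum_nonneg fun i _ => mul_nonneg (t.2.1 i) ((v i).2.1 j), ?_⟩
    rw [Finset.sum_comm]
    simp_rw [← Finset.mul_sum]
    have : ∀ i, ∑ j, (v i) j = 1 := fun i => (v i).2.2
    simp_rw [this, mul_one]
    exact t.2.2⟩
  continuous_toFun := by
    refine Continuous.subtype_mk ?_ _
    refine continuous_pi fun j => continuous_finsetSum _ fun i _ => ?_
    exact ((continuous_apply i).comp continuous_subtype_val).mul continuous_const

lemma aff_apply {k m : ℕ} (v : Fin k → D m) (t : D k) (j : Fin m) :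
    (aff v t) j = ∑ i, t i * (v i) j := rfl

lemma aff_coe {k m : ℕ} (v : Fin k → D m) (t : D k) :
    ((aff v t : D m) : Fin m → ℝ) = ∑ i, t i • ((v i : D m) : Fin m → ℝ) := by
  funext j
  simp only [Finset.sum_apply, Pi.smul_apply, smul_eq_mul]
  rfl

lemma aff_aff {k l m : ℕ} (u : Fin l → D m) (v : Fin k → D l) (t : D k) :
    aff u (aff v t) = aff (fun i => aff u (v i)) t := by
  ext j
  simp only [aff_apply, Finset.sum_mul, Finset.mul_sum]
  rw [Finset.sum_comm]
  simp only [mul_assoc]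

/-- vertices -/
noncomputable def vtx (k : ℕ) : Fin k → D k := fun i => stdSimplex.vertex i

lemma aff_vtx_apply {k : ℕ} (t : D k) : aff (vtx k) t = t := by
  ext j
  simp [aff_apply, vtx, Pi.single_apply]

lemma aff_vertex {k m : ℕ} (v : Fin k → D m) (i : Fin k) : aff v (vtx k i) = v i := by
  ext j
  simp [aff_apply, vtx, Pi.single_apply]

lemma aff_map {k l m : ℕ} (v : Fin l → D m) (f : Fin k → Fin l) (t : D k) :
    aff v (stdSimplex.map f t) = aff (fun i => v (f i)) t := by
  have : stdSimplex.map f t = aff (fun i => vtx l (f i)) t := by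
    ext j
    simp [aff_apply, vtx, Pi.single_apply, FunOnFinite.linearMap_apply_apply,
      Finset.sum_filter, eq_comm]
  rw [this, aff_aff]
  simp only [aff_vertex]

/-- barycenter of tuple -/
noncomputable def bary (m : ℕ) (k : ℕ) (v : Fin (k + 1) → D m) : D m :=
  aff v stdSimplex.barycenter

lemma aff_bary {l m k : ℕ} (u : Fin l → D m) (v : Fin (k + 1) → D l) :
    aff u (bary l k v) = bary m k (fun i => aff u (v i)) := aff_aff _ _ _

/-- hull set of a tuple -/
def hull {k m : ℕ} (v : Fin k → D m) : Set (D m) := Set.range (aff v)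

lemma hull_trans {k l m : ℕ} (v : Fin k → D m) (w : Fin l → D m) (h : ∀ i, w i ∈ hull v) :
    hull w ⊆ hull v := by
  choose u hu using h
  rintro _ ⟨t, rfl⟩
  refine ⟨aff u t, ?_⟩
  rw [aff_aff]
  simp only [hu]

lemma vert_mem_hull {k m : ℕ} (v : Fin k → D m) (i : Fin k) : v i ∈ hull v :=
  ⟨_, aff_vertex v i⟩

lemma dist_aff_le {k m : ℕ} (v : Fin k → D m) (x : D m) (r : ℝ)
    (h : ∀ i, dist (v i) x ≤ r) (t : D k) : dist (aff v t) x ≤ r := by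
  have hmem : ((aff v t : D m) : Fin m → ℝ) ∈ Metric.closedBall (x : Fin m → ℝ) r := by
    rw [aff_coe]
    exact (convex_closedBall _ r).sum_mem (fun i _ => t.2.1 i) t.2.2 (fun i _ => h i)
  exact hmem

lemma dist_bary_le {k m : ℕ} (v : Fin (k + 1) → D m) (d : ℝ)
    (h : ∀ i j, dist (v i) (v j) ≤ d) (j : Fin (k + 1)) :
    dist (v j) (bary m k v) ≤ (1 - 1 / ((k : ℝ) + 1)) * d := by
  have hk : (0 : ℝ) < (k : ℝ) + 1 := by positivity
  have hb : ((bary m k v : D m) : Fin m → ℝ) =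
      ∑ i, ((k : ℝ) + 1)⁻¹ • ((v i : D m) : Fin m → ℝ) := by
    rw [bary, aff_coe]
    refine Finset.sum_congr rfl fun i _ => ?_
    congr 1
    refine (stdSimplex.barycenter_apply (𝕜 := ℝ) (X := Fin (k+1)) i).trans ?_
    simp
  have hsub : ((v j : D m) : Fin m → ℝ) - ((bary m k v : D m) : Fin m → ℝ) =
      ∑ i, ((k : ℝ) + 1)⁻¹ • (((v j : D m) : Fin m → ℝ) - ((v i : D m) : Fin m → ℝ)) := by
    rw [hb]
    simp only [smul_sub, Finset.sum_sub_distrib]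
    congr 1
    rw [Finset.sum_const, Finset.card_univ, Fintype.card_fin, ← Nat.cast_smul_eq_nsmul ℝ, smul_smul]
    push_cast
    rw [mul_inv_cancel₀ hk.ne', one_smul]
  rw [Subtype.dist_eq, dist_eq_norm]
  refine (congrArg norm hsub).le.trans ?_
  refine (norm_sum_le _ _).trans ?_
  rw [← Finset.add_sum_erase _ _ (Finset.mem_univ j)]
  simp only [sub_self, smul_zero, norm_zero, zero_add]
  refine (Finset.sum_le_card_nsmul _ _ (((k : ℝ) + 1)⁻¹ * d) ?_).trans ?_
  · intro i _
    rw [norm_smul, Real.norm_of_nonneg (by positivity), ← dist_eq_norm]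
    gcongr
    exact h j i
  · rw [Finset.card_erase_of_mem (Finset.mem_univ _), Finset.card_univ, Fintype.card_fin]
    simp only [Nat.add_sub_cancel, nsmul_eq_mul]
    apply le_of_eq
    field_simp
    ring

/-- tuples inside hull and of small diameter -/
def smallSet {l m : ℕ} (k : ℕ) (v : Fin l → D m) (d : ℝ) : Set (Fin k → D m) :=
  {w | (∀ i j, dist (w i) (w j) ≤ d) ∧ ∀ i, w i ∈ hull v}

lemma sd_mem_smallSet (N m k : ℕ) (hk : k ≤ N + 1) (v : Fin k → D m) (d : ℝ) (hd : 0 ≤ d)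
    (h : ∀ i j, dist (v i) (v j) ≤ d) :
    sd (bary m) k (Finsupp.single v 1) ∈
      Finsupp.supported ℤ ℤ (smallSet k v ((1 - 1 / ((N : ℝ) + 1)) * d)) := by
  induction k with
  | zero =>
    simp only [sd, LinearMap.id_apply]
    exact Finsupp.single_mem_supported _ _ ⟨fun i => i.elim0, fun i => i.elim0⟩
  | succ k ih =>
    rw [sd_single, bd_single]
    have hr : (0 : ℝ) ≤ 1 - 1 / ((N : ℝ) + 1) := by
      rw [sub_nonneg, div_le_one (by positivity)]; simp
    have hmem : sd (bary m) k (∑ i : Fin (k + 1), (-1 : ℤ) ^ (i : ℕ) •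
        Finsupp.single (fun j => v (i.succAbove j)) (1 : ℤ)) ∈
        Finsupp.supported ℤ ℤ (smallSet k v ((1 - 1 / ((N : ℝ) + 1)) * d)) := by
      rw [map_sum]
      refine Submodule.sum_mem _ fun i _ => ?_
      rw [map_smul]
      refine Submodule.smul_mem _ _ ?_
      refine Finsupp.supported_mono ?_ (ih (by omega) (fun j => v (i.succAbove j))
        (fun a c => h _ _))
      rintro w ⟨h1, h2⟩
      refine ⟨h1, fun a => ?_⟩
      exact hull_trans v _ (fun j => vert_mem_hull v _) (h2 a)
    refine lin_mem _ _ _ ?_ _ hmem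
    rintro w ⟨h1, h2⟩
    rw [cone_single]
    refine Finsupp.single_mem_supported _ _ ?_
    have key : ∀ x ∈ hull v, dist x (bary m k v) ≤ (1 - 1 / ((N : ℝ) + 1)) * d := by
      rintro _ ⟨t, rfl⟩
      refine dist_aff_le _ _ _ (fun i => (dist_bary_le v d h i).trans ?_) _
      gcongr
      exact_mod_cast Nat.lt_succ_iff.mp hk
    constructor
    · intro i j
      refine Fin.cases ?_ (fun i => ?_) i <;> refine Fin.cases ?_ (fun j => ?_) j
      · simp only [dist_self]; positivity
      · simp only [Fin.cons_zero, Fin.cons_succ]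
        rw [dist_comm]
        exact key _ (h2 j)
      · simp only [Fin.cons_zero, Fin.cons_succ]
        exact key _ (h2 i)
      · simpa using h1 i j
    · intro i
      refine Fin.cases ?_ (fun i => ?_) i
      · exact ⟨_, rfl⟩
      · simpa using h2 i

lemma sd_iter_mem (m k n : ℕ) (v : Fin (k + 1) → D m) (d : ℝ) (hd : 0 ≤ d)
    (h : ∀ i j, dist (v i) (v j) ≤ d) :
    (sd (bary m) (k + 1))^[n] (Finsupp.single v 1) ∈
      Finsupp.supported ℤ ℤ
        {w : Fin (k + 1) → D m | ∀ i j, dist (w i) (w j) ≤ (1 - 1 / ((k : ℝ) + 1)) ^ n * d} := by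
  have hr : (0 : ℝ) ≤ 1 - 1 / ((k : ℝ) + 1) := by
    rw [sub_nonneg, div_le_one (by positivity)]; simp
  induction n with
  | zero =>
    simp only [Function.iterate_zero, id_eq, pow_zero, one_mul]
    exact Finsupp.single_mem_supported _ _ h
  | succ n ih =>
    rw [Function.iterate_succ_apply']
    refine lin_mem _ _ _ ?_ _ ih
    intro w hw
    refine Finsupp.supported_mono ?_ (sd_mem_smallSet k m (k+1) le_rfl w _ (by positivity) hw)
    rintro u ⟨hu, -⟩
    rw [pow_succ', mul_assoc]
    exact hu

end
end SuspAux

namespace SuspAux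
section
/-- singular chains (augmented, shifted by one) -/
abbrev G (Y : Type) [TopologicalSpace Y] (k : ℕ) := C(D k, Y) →₀ ℤ

/-- face inclusion -/
noncomputable def face (k : ℕ) (i : Fin (k + 1)) : C(D k, D (k + 1)) :=
  ⟨stdSimplex.map i.succAbove, stdSimplex.continuous_map _⟩

variable {Y : Type} [TopologicalSpace Y]

/-- singular boundary -/
noncomputable def dS (Y : Type) [TopologicalSpace Y] (k : ℕ) : G Y (k + 1) →ₗ[ℤ] G Y k :=
  Finsupp.linearCombination ℤ
    (fun τ => ∑ i : Fin (k + 1), (-1 : ℤ) ^ (i : ℕ) • Finsupp.single (τ.comp (face k i)) (1 : ℤ))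

lemma dS_single {k : ℕ} (τ : C(D (k + 1), Y)) : dS Y k (Finsupp.single τ 1) =
    ∑ i : Fin (k + 1), (-1 : ℤ) ^ (i : ℕ) • Finsupp.single (τ.comp (face k i)) (1 : ℤ) := by
  simp [dS]

/-- realize affine chains in a singular simplex -/
noncomputable def phi {m : ℕ} (τ : C(D m, Y)) (k : ℕ) : L (D m) k →ₗ[ℤ] G Y k :=
  Finsupp.linearCombination ℤ (fun v => Finsupp.single (τ.comp (aff v)) (1 : ℤ))

lemma phi_single {m : ℕ} (τ : C(D m, Y)) {k : ℕ} (v : Fin k → D m) :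
    phi τ k (Finsupp.single v 1) = Finsupp.single (τ.comp (aff v)) (1 : ℤ) := by
  simp [phi]

lemma phi_vtx {m : ℕ} (τ : C(D m, Y)) :
    phi τ m (Finsupp.single (vtx m) 1) = Finsupp.single τ (1 : ℤ) := by
  rw [phi_single]
  congr 1
  ext t
  simp [aff_vtx_apply]

lemma dS_phi {m : ℕ} (τ : C(D m, Y)) (k : ℕ) (x : L (D m) (k + 1)) :
    dS Y k (phi τ (k + 1) x) = phi τ k (bd (D m) k x) := by
  suffices h : (dS Y k).comp (phi τ (k+1)) = (phi τ k).comp (bd (D m) k) from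
    LinearMap.congr_fun h x
  ext v : 2
  simp only [LinearMap.comp_apply, Finsupp.lsingle_apply, phi_single, dS_single, bd_single,
    map_sum, map_smul]
  refine Finset.sum_congr rfl fun i _ => ?_
  congr 2
  ext t
  simp only [ContinuousMap.comp_apply]
  congr 1
  exact aff_map v _ t

lemma phi_push {m l : ℕ} (τ : C(D m, Y)) (u : Fin l → D m) (k : ℕ) (x : L (D l) k) :
    phi τ k (push (aff u) k x) = phi (τ.comp (aff u)) k x := by
  suffices h : (phi τ k).comp (push (aff u) k) = phi (τ.comp (aff u)) k from
    LinearMap.congr_fun h x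
  ext v : 2
  simp only [LinearMap.comp_apply, Finsupp.lsingle_apply, phi_single, push_single]
  congr 1
  ext t
  simp only [ContinuousMap.comp_apply]
  rw [aff_aff]

/-- singular subdivision -/
noncomputable def sdS (Y : Type) [TopologicalSpace Y] (k : ℕ) : G Y k →ₗ[ℤ] G Y k :=
  Finsupp.linearCombination ℤ
    (fun τ => phi τ k (sd (bary k) k (Finsupp.single (vtx k) 1)))

/-- singular homotopy -/
noncomputable def htS (Y : Type) [TopologicalSpace Y] (k : ℕ) : G Y k →ₗ[ℤ] G Y (k + 1) :=
  Finsupp.linearCombination ℤ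
    (fun τ => phi τ (k + 1) (ht (bary k) k (Finsupp.single (vtx k) 1)))

lemma sdS_single {k : ℕ} (τ : C(D k, Y)) : sdS Y k (Finsupp.single τ 1) =
    phi τ k (sd (bary k) k (Finsupp.single (vtx k) 1)) := by
  simp [sdS]

lemma htS_single {k : ℕ} (τ : C(D k, Y)) : htS Y k (Finsupp.single τ 1) =
    phi τ (k + 1) (ht (bary k) k (Finsupp.single (vtx k) 1)) := by
  simp [htS]

lemma sdS_phi {m : ℕ} (τ : C(D m, Y)) (k : ℕ) (x : L (D m) k) :
    sdS Y k (phi τ k x) = phi τ k (sd (bary m) k x) := by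
  suffices h : (sdS Y k).comp (phi τ k) = (phi τ k).comp (sd (bary m) k) from
    LinearMap.congr_fun h x
  ext v : 2
  simp only [LinearMap.comp_apply, Finsupp.lsingle_apply, phi_single, sdS_single]
  rw [← phi_push, push_sd (aff v) (bary k) (bary m) (fun _ _ => aff_bary _ _), push_single]
  simp only [aff_vertex]

lemma htS_phi {m : ℕ} (τ : C(D m, Y)) (k : ℕ) (x : L (D m) k) :
    htS Y k (phi τ k x) = phi τ (k + 1) (ht (bary m) k x) := by
  suffices h : (htS Y k).comp (phi τ k) = (phi τ (k + 1)).comp (ht (bary m) k) from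
    LinearMap.congr_fun h x
  ext v : 2
  simp only [LinearMap.comp_apply, Finsupp.lsingle_apply, phi_single, htS_single]
  rw [← phi_push, push_ht (aff v) (bary k) (bary m) (fun _ _ => aff_bary _ _), push_single]
  simp only [aff_vertex]

lemma dS_sdS (k : ℕ) (x : G Y (k + 1)) : dS Y k (sdS Y (k + 1) x) = sdS Y k (dS Y k x) := by
  suffices h : (dS Y k).comp (sdS Y (k + 1)) = (sdS Y k).comp (dS Y k) from
    LinearMap.congr_fun h x
  ext τ : 2
  simp only [LinearMap.comp_apply, Finsupp.lsingle_apply]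
  rw [sdS_single, dS_phi, bd_sd, ← sdS_phi, ← dS_phi, phi_vtx]

lemma dS_htS (k : ℕ) (x : G Y (k + 1)) :
    dS Y (k + 1) (htS Y (k + 1) x) = x - sdS Y (k + 1) x - htS Y k (dS Y k x) := by
  suffices h : (dS Y (k + 1)).comp (htS Y (k + 1)) =
      LinearMap.id - sdS Y (k + 1) - (htS Y k).comp (dS Y k) from
    LinearMap.congr_fun h x
  ext τ : 2
  simp only [LinearMap.comp_apply, Finsupp.lsingle_apply, LinearMap.sub_apply, LinearMap.id_apply]
  rw [htS_single, dS_phi, bd_ht, map_sub, map_sub, ← htS_phi, ← dS_phi, ← sdS_phi, phi_vtx]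

/-- small simplices -/
def Sm (U V : Set Y) (k : ℕ) : Set (C(D k, Y)) :=
  {τ | (∀ t, τ t ∈ U) ∨ (∀ t, τ t ∈ V)}

lemma phi_mem {U V : Set Y} {m : ℕ} {τ : C(D m, Y)} (hτ : τ ∈ Sm U V m) (k : ℕ) (x : L (D m) k) :
    phi τ k x ∈ Finsupp.supported ℤ ℤ (Sm U V k) := by
  refine lin_mem _ Set.univ _ (fun v _ => ?_) _ (by simp)
  rw [phi_single]
  refine Finsupp.single_mem_supported _ _ ?_
  rcases hτ with h | h
  · exact Or.inl fun t => h _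
  · exact Or.inr fun t => h _

lemma sdS_mem {U V : Set Y} {k : ℕ} {x : G Y k} (hx : x ∈ Finsupp.supported ℤ ℤ (Sm U V k)) :
    sdS Y k x ∈ Finsupp.supported ℤ ℤ (Sm U V k) := by
  refine lin_mem _ _ _ (fun τ hτ => ?_) _ hx
  rw [sdS_single]
  exact phi_mem hτ _ _

lemma htS_mem {U V : Set Y} {k : ℕ} {x : G Y k} (hx : x ∈ Finsupp.supported ℤ ℤ (Sm U V k)) :
    htS Y k x ∈ Finsupp.supported ℤ ℤ (Sm U V (k + 1)) := by
  refine lin_mem _ _ _ (fun τ hτ => ?_) _ hx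
  rw [htS_single]
  exact phi_mem hτ _ _

lemma sdS_iter_phi {m : ℕ} (τ : C(D m, Y)) (k n : ℕ) (x : L (D m) k) :
    (sdS Y k)^[n] (phi τ k x) = phi τ k ((sd (bary m) k)^[n] x) := by
  induction n with
  | zero => rfl
  | succ n ih => rw [Function.iterate_succ_apply', Function.iterate_succ_apply', ih, sdS_phi]

instance (k : ℕ) : CompactSpace (D k) := isCompact_iff_compactSpace.mp (isCompact_stdSimplex ℝ _)

lemma exists_iter_single {U V : Set Y} (hU : IsOpen U) (hV : IsOpen V) (hUV : U ∪ V = Set.univ)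
    {k : ℕ} (τ : C(D (k + 1), Y)) :
    ∃ n, (sdS Y (k + 1))^[n] (Finsupp.single τ 1) ∈ Finsupp.supported ℤ ℤ (Sm U V (k + 1)) := by
  obtain ⟨δ, hδ, hleb⟩ := lebesgue_number_lemma_of_metric (s := (Set.univ : Set (D (k + 1))))
    (c := fun b : Bool => if b then τ ⁻¹' U else τ ⁻¹' V) isCompact_univ
    (by
      intro b
      cases b
      · simpa using hV.preimage τ.continuous
      · simpa using hU.preimage τ.continuous)
    (by
      intro t _
      have : τ t ∈ U ∪ V := by rw [hUV]; trivial
      rw [Set.mem_iUnion]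
      rcases this with h | h
      · exact ⟨true, by simpa using h⟩
      · exact ⟨false, by simpa using h⟩)
  have hr : (0 : ℝ) ≤ 1 - 1 / ((k : ℝ) + 1) := by
    rw [sub_nonneg, div_le_one (by positivity)]; simp
  have hr1 : 1 - 1 / ((k : ℝ) + 1) < 1 := by
    have : 0 < 1 / ((k : ℝ) + 1) := by positivity
    linarith
  have hdiam : ∀ i j, dist (vtx (k + 1) i) (vtx (k + 1) j) ≤ Metric.diam (Set.univ : Set (D (k + 1))) :=
    fun i j => Metric.dist_le_diam_of_mem isCompact_univ.isBounded trivial trivial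
  obtain ⟨n, hn⟩ : ∃ n : ℕ,
      (1 - 1 / ((k : ℝ) + 1)) ^ n * Metric.diam (Set.univ : Set (D (k + 1))) < δ := by
    have := (tendsto_pow_atTop_nhds_zero_of_lt_one hr hr1).mul_const
      (Metric.diam (Set.univ : Set (D (k + 1))))
    rw [zero_mul] at this
    exact (this.eventually (gt_mem_nhds hδ)).exists
  refine ⟨n, ?_⟩
  rw [← phi_vtx, sdS_iter_phi]
  refine lin_mem _ _ _ ?_ _ (sd_iter_mem (k + 1) k n (vtx (k + 1)) _ Metric.diam_nonneg hdiam)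
  intro w hw
  rw [phi_single]
  refine Finsupp.single_mem_supported _ _ ?_
  obtain ⟨c, hc⟩ := hleb (w 0) trivial
  have hin : ∀ t, aff w t ∈ Metric.ball (w 0) δ := fun t =>
    lt_of_le_of_lt (dist_aff_le w (w 0) _ (fun i => hw i 0) t) hn
  cases c
  · exact Or.inr fun t => by simpa using hc (hin t)
  · exact Or.inl fun t => by simpa using hc (hin t)

lemma sdS_iter_mem {U V : Set Y} {k : ℕ} (n : ℕ) {x : G Y k}
    (hx : x ∈ Finsupp.supported ℤ ℤ (Sm U V k)) :
    (sdS Y k)^[n] x ∈ Finsupp.supported ℤ ℤ (Sm U V k) := by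
  induction n with
  | zero => exact hx
  | succ n ih => rw [Function.iterate_succ_apply']; exact sdS_mem ih

lemma exists_iter {U V : Set Y} (hU : IsOpen U) (hV : IsOpen V) (hUV : U ∪ V = Set.univ)
    {k : ℕ} (x : G Y (k + 1)) :
    ∃ n, (sdS Y (k + 1))^[n] x ∈ Finsupp.supported ℤ ℤ (Sm U V (k + 1)) := by
  induction x using Finsupp.induction_linear with
  | zero => exact ⟨0, Submodule.zero_mem _⟩
  | add f g hf hg =>
    obtain ⟨n, hn⟩ := hf
    obtain ⟨p, hp⟩ := hg
    refine ⟨n + p, ?_⟩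
    rw [← Module.End.pow_apply, map_add]
    refine Submodule.add_mem _ ?_ ?_
    · rw [Module.End.pow_apply, add_comm n p, Function.iterate_add_apply]
      exact sdS_iter_mem _ hn
    · rw [Module.End.pow_apply, Function.iterate_add_apply]
      exact sdS_iter_mem _ hp
  | single τ c =>
    obtain ⟨n, hn⟩ := exists_iter_single hU hV hUV τ
    refine ⟨n, ?_⟩
    have : Finsupp.single τ c = c • Finsupp.single τ (1 : ℤ) := by simp
    rw [this, ← Module.End.pow_apply, map_smul, Module.End.pow_apply]
    exact Submodule.smul_mem _ _ hn

theorem small_main {U V : Set Y} (hU : IsOpen U) (hV : IsOpen V) (hUV : U ∪ V = Set.univ)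
    {k : ℕ} (z : G Y (k + 1)) (hz : dS Y k z ∈ Finsupp.supported ℤ ℤ (Sm U V k)) :
    ∃ w : G Y (k + 2), z - dS Y (k + 1) w ∈ Finsupp.supported ℤ ℤ (Sm U V (k + 1)) := by
  obtain ⟨n, hn⟩ := exists_iter hU hV hUV z
  induction n generalizing z with
  | zero => exact ⟨0, by simpa using hn⟩
  | succ n ih =>
    obtain ⟨w, hw⟩ := ih (sdS Y (k + 1) z) (by rw [dS_sdS]; exact sdS_mem hz) hn
    refine ⟨w + htS Y (k + 1) z, ?_⟩
    rw [map_add, dS_htS]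
    have : z - (dS Y (k + 1) w + (z - sdS Y (k + 1) z - htS Y k (dS Y k z))) =
      (sdS Y (k + 1) z - dS Y (k + 1) w) + htS Y k (dS Y k z) := by abel
    rw [this]
    exact Submodule.add_mem _ hw (htS_mem hz)

end
end SuspAux

namespace SuspAux
section
open Limits
universe u
/-- core homological lemma -/
theorem hom_lemma {K M N : ChainComplex (ModuleCat.{u} ℤ) ℕ} (f : K ⟶ M) (g : M ⟶ N) (w : f ≫ g = 0)
    (hf : ∀ n, Function.Injective (f.f n))
    (hex : ∀ n (x : M.X n), g.f n x = 0 → ∃ y : K.X n, f.f n y = x)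
    (hs : ∀ n (z : N.X (n + 1)), (∃ y : M.X n, g.f n y = N.d (n + 1) n z) →
      ∃ (t : N.X (n + 2)) (y : M.X (n + 1)), g.f (n + 1) y = z - N.d (n + 2) (n + 1) t)
    (i : ℕ) (h0 : IsZero (M.homology i)) (h1 : IsZero (M.homology (i + 1))) :
    Nonempty (N.homology (i + 1) ≅ K.homology i) := by
  have hfm : Mono f := by
    have : ∀ n, Mono (f.f n) := fun n => (ModuleCat.mono_iff_injective _).2 (hf n)
    exact HomologicalComplex.mono_of_mono_f f this
  have hexact : (ShortComplex.mk f g w).Exact := by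
    rw [HomologicalComplex.exact_iff_degreewise_exact]
    intro n
    rw [ShortComplex.moduleCat_exact_iff]
    exact hex n
  let ι := Abelian.image.ι g
  let p := Abelian.factorThruImage g
  have hp : p ≫ ι = g := Abelian.image.fac g
  have w1 : f ≫ p = 0 := by
    rw [← cancel_mono ι, Category.assoc, hp, w, zero_comp]
  have S1 : (ShortComplex.mk f p w1).ShortExact := by
    have : (ShortComplex.mk f p w1).Exact := by
      let φ : ShortComplex.mk f p w1 ⟶ ShortComplex.mk f g w :=
        { τ₁ := 𝟙 _, τ₂ := 𝟙 _, τ₃ := ι }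
      rw [ShortComplex.exact_iff_of_epi_of_isIso_of_mono φ]
      exact hexact
    exact { exact := this, mono_f := hfm, epi_g := inferInstanceAs (Epi p) }
  let q := cokernel.π g
  have w2 : ι ≫ q = 0 := kernel.condition _
  have S2 : (ShortComplex.mk ι q w2).ShortExact := by
    have : (ShortComplex.mk ι q w2).Exact :=
      ShortComplex.exact_of_f_is_kernel _ (kernelIsKernel q)
    exact { exact := this, mono_f := inferInstanceAs (Mono ι), epi_g := inferInstanceAs (Epi q) }
  have S3 : (ShortComplex.mk g q (cokernel.condition g)).Exact :=
    ShortComplex.exact_of_g_is_cokernel _ (cokernelIsCokernel g)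
  rw [HomologicalComplex.exact_iff_degreewise_exact] at S3
  have hq : ∀ n, Function.Surjective (q.f n) := fun n => by
    rw [← ModuleCat.epi_iff_surjective]; infer_instance
  have hker : ∀ n (x : N.X n), q.f n x = 0 → ∃ y, g.f n y = x := fun n => by
    have := S3 n
    rw [ShortComplex.moduleCat_exact_iff] at this
    exact this
  have hgq : ∀ n (y : M.X n), q.f n (g.f n y) = 0 := fun n y => by
    have : g.f n ≫ q.f n = 0 := by
      rw [← HomologicalComplex.comp_f, cokernel.condition]; rfl
    exact congrArg (fun h => h.hom y) this
  have comm : ∀ n (x : N.X (n + 1)), (cokernel g).d (n + 1) n (q.f (n + 1) x) = q.f n (N.d (n + 1) n x) := by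
    intro n x
    exact congrArg (fun h => h.hom x) (q.comm (n + 1) n)
  have hQ : ∀ n, IsZero ((cokernel g).homology (n + 1)) := by
    intro n
    rw [← HomologicalComplex.exactAt_iff_isZero_homology,
      HomologicalComplex.exactAt_iff' _ (n + 2) (n + 1) n (by simp) (by simp),
      ShortComplex.moduleCat_exact_iff]
    intro x hx
    obtain ⟨z, rfl⟩ := hq _ x
    change (cokernel g).d (n + 1) n (q.f (n + 1) z) = 0 at hx
    rw [comm] at hx
    obtain ⟨t, y, hy⟩ := hs n z (hker _ _ hx)
    refine ⟨q.f _ t, ?_⟩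
    change (cokernel g).d (n + 2) (n + 1) (q.f (n + 2) t) = q.f (n + 1) z
    rw [comm (n + 1)]
    have := hgq _ y
    rw [hy, map_sub, sub_eq_zero] at this
    exact this.symm
  have e1 : (Abelian.image g).homology (i + 1) ≅ K.homology i :=
    S1.δIso (i + 1) i (by simp) h1 h0
  have : Mono (HomologicalComplex.homologyMap ι (i + 1)) :=
    (S2.homology_exact₁ (i + 2) (i + 1) (by simp)).mono_g
      (by apply (hQ (i + 1)).eq_of_src)
  have : Epi (HomologicalComplex.homologyMap ι (i + 1)) :=
    (S2.homology_exact₂ (i + 1)).epi_f (by apply (hQ i).eq_of_tgt)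
  have := isIso_of_mono_of_epi (HomologicalComplex.homologyMap ι (i + 1))
  exact ⟨(asIso (HomologicalComplex.homologyMap ι (i + 1))).symm ≪≫ e1⟩

end
end SuspAux

namespace SuspAux
section
open Limits
open Opposite Simplicial

/-- singular chains as a functor -/
noncomputable def chF : TopCat.{0} ⥤ ChainComplex (ModuleCat.{0} ℤ) ℕ :=
  TopCat.toSSet ⋙ (SimplicialObject.whiskering _ _).obj (ModuleCat.free ℤ) ⋙
    AlgebraicTopology.alternatingFaceMapComplex (ModuleCat ℤ)

/-- identification of singular chains with finitely supported functions -/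
noncomputable def E (Y : TopCat.{0}) (n : ℕ) : (chF.obj Y).X n ≃ₗ[ℤ] G Y (n + 1) :=
  Finsupp.domLCongr (Y.toSSetObjEquiv (op ⦋n⦌))

/-- basis simplices -/
noncomputable def bas (Y : TopCat.{0}) (n : ℕ) (s : (TopCat.toSSet.obj Y).obj (op ⦋n⦌)) :
    (chF.obj Y).X n := ModuleCat.freeMk (R := ℤ) s

lemma E_bas (Y : TopCat.{0}) (n : ℕ) (s : (TopCat.toSSet.obj Y).obj (op ⦋n⦌)) :
    E Y n (bas Y n s) = Finsupp.single (Y.toSSetObjEquiv (op ⦋n⦌) s) 1 :=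
  Finsupp.domLCongr_single (R := ℤ) _ _ _

lemma bas_ext {Y : TopCat.{0}} {n : ℕ} {N : Type*} [AddCommGroup N]
    (f g : (chF.obj Y).X n →ₗ[ℤ] N) (h : ∀ s, f (bas Y n s) = g (bas Y n s)) : f = g := by
  apply Finsupp.lhom_ext'
  intro s
  apply LinearMap.ext_ring
  exact h s

lemma objD_apply (A : SimplicialObject (ModuleCat.{0} ℤ)) (n : ℕ) (x : A.obj (op ⦋n + 1⦌)) :
    (AlgebraicTopology.AlternatingFaceMapComplex.objD A n).hom x =
      ∑ i : Fin (n + 2), (-1 : ℤ) ^ (i : ℕ) • (A.δ i).hom x := by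
  rw [AlgebraicTopology.AlternatingFaceMapComplex.objD, ModuleCat.hom_sum, LinearMap.sum_apply]
  refine Finset.sum_congr rfl fun i _ => ?_
  rfl

lemma E_d (Y : TopCat.{0}) (n : ℕ) (x : (chF.obj Y).X (n + 1)) :
    E Y n ((chF.obj Y).d (n + 1) n x) = dS Y (n + 1) (E Y (n + 1) x) := by
  have : (E Y n).toLinearMap.comp ((chF.obj Y).d (n + 1) n).hom =
      (dS Y (n + 1)).comp (E Y (n + 1)).toLinearMap := by
    apply bas_ext
    intro s
    have e1 : (chF.obj Y).d (n + 1) n = AlgebraicTopology.AlternatingFaceMapComplex.objD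
      (((SimplicialObject.whiskering _ _).obj (ModuleCat.free ℤ)).obj (TopCat.toSSet.obj Y)) n :=
      AlgebraicTopology.alternatingFaceMapComplex_obj_d _ n
    have e2 : ((chF.obj Y).d (n + 1) n).hom (bas Y (n + 1) s) =
        ∑ i : Fin (n + 2), (-1 : ℤ) ^ (i : ℕ) • bas Y n ((TopCat.toSSet.obj Y).δ i s) := by
      rw [e1]
      refine (objD_apply _ n _).trans ?_
      refine Finset.sum_congr rfl fun i _ => ?_
      congr 1
      exact ModuleCat.free_map_apply (R := ℤ) _ _
    simp only [LinearMap.comp_apply, LinearEquiv.coe_coe]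
    rw [e2, E_bas, dS_single, map_sum]
    refine Finset.sum_congr rfl fun i _ => ?_
    rw [map_smul, E_bas]
    congr 2
  exact LinearMap.congr_fun this x

lemma E_map {Y Z : TopCat.{0}} (f : Y ⟶ Z) (n : ℕ) (x : (chF.obj Y).X n) :
    E Z n ((chF.map f).f n x) = Finsupp.lmapDomain ℤ ℤ (fun τ => f.hom.comp τ) (E Y n x) := by
  have : (E Z n).toLinearMap.comp ((chF.map f).f n).hom =
      (Finsupp.lmapDomain ℤ ℤ (fun τ : C(D (n + 1), Y) => f.hom.comp τ)).comp
        (E Y n).toLinearMap := by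
    apply bas_ext
    intro s
    have e2 : ((chF.map f).f n).hom (bas Y n s) = bas Z n ((TopCat.toSSet.map f).app _ s) :=
      ModuleCat.free_map_apply (R := ℤ) _ _
    simp only [LinearMap.comp_apply, LinearEquiv.coe_coe]
    rw [e2, E_bas, E_bas, Finsupp.lmapDomain_apply, Finsupp.mapDomain_single]
    congr 1
  exact LinearMap.congr_fun this x

/-- homology functor -/
noncomputable abbrev Hn (n : ℕ) : TopCat.{0} ⥤ ModuleCat.{0} ℤ :=
  chF ⋙ HomologicalComplex.homologyFunctor _ _ n

lemma Hn_htpy {Y Z : TopCat.{0}} (f g : Y ⟶ Z) (H : ContinuousMap.Homotopy f.hom g.hom) (n : ℕ) :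
    (Hn n).map f = (Hn n).map g := by
  let H1 : TopCat.Homotopy f g := H
  exact (SimplicialObject.Homotopy.toChainHomotopy
    (H1.toSSet.toSimplicialObjectHomotopy.whiskerRight (ModuleCat.free ℤ))).homologyMap_eq n

lemma Hn_point (Y : TopCat.{0}) [TotallyDisconnectedSpace Y] (n : ℕ) (hn : n ≠ 0) :
    IsZero ((Hn n).obj Y) := by
  let e : chF.obj Y ≅ (ChainComplex.alternatingConst).obj ((ModuleCat.free ℤ).obj Y) :=
    (AlgebraicTopology.alternatingFaceMapComplex _).mapIso
      (((SimplicialObject.whiskering _ _).obj _).mapIso (TopCat.toSSetIsoConst Y) ≪≫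
        Functor.constComp _ _ _) ≪≫ AlgebraicTopology.alternatingFaceMapComplexConst.app _
  refine IsZero.of_iso ?_ ((HomologicalComplex.homologyFunctor _ _ n).mapIso e)
  exact (ChainComplex.alternatingConst_exactAt _ _ hn).isZero_homology

lemma Hn_contr (Y : TopCat.{0}) (y : Y)
    (H : ContinuousMap.Homotopy (ContinuousMap.id Y) (ContinuousMap.const Y y))
    (n : ℕ) (hn : n ≠ 0) : IsZero ((Hn n).obj Y) := by
  let p : Y ⟶ TopCat.of PUnit.{1} := TopCat.ofHom (ContinuousMap.const _ PUnit.unit)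
  let q : TopCat.of PUnit.{1} ⟶ Y := TopCat.ofHom (ContinuousMap.const _ y)
  have e : (Hn n).map (𝟙 Y) = (Hn n).map (p ≫ q) := Hn_htpy (𝟙 Y) (p ≫ q) H n
  rw [Functor.map_comp, (Hn_point (TopCat.of PUnit.{1}) n hn).eq_of_src ((Hn n).map q) 0, comp_zero,
    CategoryTheory.Functor.map_id] at e
  exact (IsZero.iff_id_eq_zero _).2 e

lemma Hn_equiv {Y Z : TopCat.{0}} (p : Y ⟶ Z) (q : Z ⟶ Y) (h1 : q ≫ p = 𝟙 Z)
    (H : ContinuousMap.Homotopy (𝟙 Y : Y ⟶ Y).hom (p ≫ q).hom) (n : ℕ) :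
    Nonempty ((Hn n).obj Y ≅ (Hn n).obj Z) := by
  refine ⟨⟨(Hn n).map p, (Hn n).map q, ?_, ?_⟩⟩
  · rw [← Functor.map_comp, ← Hn_htpy _ _ H, CategoryTheory.Functor.map_id]
  · rw [← Functor.map_comp, h1, CategoryTheory.Functor.map_id]

end
end SuspAux

namespace SuspAux
section
open Limits
/-- subspace inclusions -/
def inc {Y : Type} [TopologicalSpace Y] {A B : Set Y} (h : A ⊆ B) : TopCat.of A ⟶ TopCat.of B :=
  TopCat.ofHom ⟨Set.inclusion h, continuous_inclusion h⟩

/-- inclusion in the whole space -/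
def incl {Y : Type} [TopologicalSpace Y] (A : Set Y) : TopCat.of A ⟶ TopCat.of Y :=
  TopCat.ofHom ⟨Subtype.val, continuous_subtype_val⟩

lemma inc_incl {Y : Type} [TopologicalSpace Y] {A B : Set Y} (h : A ⊆ B) :
    inc h ≫ incl B = incl A := rfl

lemma comp_inj {Y Z : TopCat.{0}} (f : Y ⟶ Z) (hf : Function.Injective f) (k : ℕ) :
    Function.Injective (fun τ : C(D k, Y) => f.hom.comp τ) := by
  intro a b h
  ext t
  apply hf
  exact DFunLike.congr_fun h t

lemma chF_inj {Y Z : TopCat.{0}} (f : Y ⟶ Z) (hf : Function.Injective f) (n : ℕ) :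
    Function.Injective ((chF.map f).f n) := by
  intro a b h
  apply (E Y n).injective
  have := congrArg (E Z n) h
  rw [E_map, E_map] at this
  exact Finsupp.mapDomain_injective (comp_inj f hf _) this

lemma incl_inj {Y : Type} [TopologicalSpace Y] (A : Set Y) : Function.Injective (incl A) :=
  Subtype.val_injective

lemma inc_inj {Y : Type} [TopologicalSpace Y] {A B : Set Y} (h : A ⊆ B) :
    Function.Injective (inc h) :=
  Set.inclusion_injective h

/-- range of chains of a subspace -/
lemma range_incl {Y : Type} [TopologicalSpace Y] (A : Set Y) (n : ℕ) (z : (chF.obj (TopCat.of Y)).X n) :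
    (∃ a, (chF.map (incl A)).f n a = z) ↔
      E (TopCat.of Y) n z ∈ Finsupp.supported ℤ ℤ {τ : C(D (n + 1), Y) | ∀ t, τ t ∈ A} := by
  constructor
  · rintro ⟨a, rfl⟩
    rw [E_map, Finsupp.lmapDomain_apply, Finsupp.mem_supported]
    classical
    intro τ hτ
    have := Finsupp.mapDomain_support hτ
    rw [Finset.mem_image] at this
    obtain ⟨τ', -, rfl⟩ := this
    intro t
    exact (τ' t).2
  · intro h
    have hs : E (TopCat.of Y) n z ∈ LinearMap.range
        (Finsupp.lmapDomain ℤ ℤ (fun τ : C(D (n + 1), A) => (incl A).hom.comp τ)) := by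
      rw [Finsupp.mem_supported] at h
      rw [← Finsupp.sum_single (E (TopCat.of Y) n z)]
      refine Submodule.sum_mem _ fun τ hτ => ?_
      refine ⟨Finsupp.single ⟨fun t => ⟨τ t, h hτ t⟩, by fun_prop⟩ (E (TopCat.of Y) n z τ), ?_⟩
      rw [Finsupp.lmapDomain_apply, Finsupp.mapDomain_single]
      congr 1
    obtain ⟨b, hb⟩ := hs
    refine ⟨(E (TopCat.of A) n).symm b, ?_⟩
    apply (E (TopCat.of Y) n).injective
    rw [E_map, LinearEquiv.apply_symm_apply]
    exact hb

lemma map_inc_incl {Y : Type} [TopologicalSpace Y] {A B : Set Y} (h : A ⊆ B) (n : ℕ)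
    (x : (chF.obj (TopCat.of A)).X n) :
    (chF.map (incl B)).f n ((chF.map (inc h)).f n x) = (chF.map (incl A)).f n x := by
  have : chF.map (inc h) ≫ chF.map (incl B) = chF.map (incl A) := by
    rw [← Functor.map_comp, inc_incl]
  have := congrArg (fun q => (q.f n).hom x) this
  exact this

section bi
variable {K L N : ChainComplex (ModuleCat.{0} ℤ) ℕ}

lemma desc_apply (a : K ⟶ N) (b : L ⟶ N) (n : ℕ) (x : (K ⊞ L).X n) :
    (biprod.desc a b).f n x = a.f n ((biprod.fst : K ⊞ L ⟶ K).f n x) +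
      b.f n ((biprod.snd : K ⊞ L ⟶ L).f n x) := by
  have : biprod.desc a b = biprod.fst ≫ a + biprod.snd ≫ b := biprod.desc_eq
  rw [this]; rfl

lemma inl_inr_apply (n : ℕ) (x : (K ⊞ L).X n) :
    (biprod.inl : K ⟶ K ⊞ L).f n ((biprod.fst : K ⊞ L ⟶ K).f n x) +
      (biprod.inr : L ⟶ K ⊞ L).f n ((biprod.snd : K ⊞ L ⟶ L).f n x) = x := by
  have : biprod.fst ≫ biprod.inl + biprod.snd ≫ biprod.inr = 𝟙 (K ⊞ L) := biprod.total
  exact congrArg (fun q => (q.f n).hom x) this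

lemma lift_apply (a : N ⟶ K) (b : N ⟶ L) (n : ℕ) (x : N.X n) :
    (biprod.lift a b).f n x = (biprod.inl : K ⟶ K ⊞ L).f n (a.f n x) +
      (biprod.inr : L ⟶ K ⊞ L).f n (b.f n x) := by
  have : biprod.lift a b = a ≫ biprod.inl + b ≫ biprod.inr := biprod.lift_eq
  rw [this]; rfl

lemma desc_mk (a : K ⟶ N) (b : L ⟶ N) (n : ℕ) (x : K.X n) (y : L.X n) :
    (biprod.desc a b).f n ((biprod.inl : K ⟶ K ⊞ L).f n x +
      (biprod.inr : L ⟶ K ⊞ L).f n y) = a.f n x + b.f n y := by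
  rw [map_add]
  congr 1
  · have : biprod.inl ≫ biprod.desc a b = a := by simp
    exact congrArg (fun q => (q.f n).hom x) this
  · have : biprod.inr ≫ biprod.desc a b = b := by simp
    exact congrArg (fun q => (q.f n).hom y) this

lemma isZero_biprod (n : ℕ) (hK : IsZero (K.homology n)) (hL : IsZero (L.homology n)) :
    IsZero ((K ⊞ L).homology n) := by
  rw [IsZero.iff_id_eq_zero]
  have e : biprod.fst ≫ biprod.inl + biprod.snd ≫ biprod.inr = 𝟙 (K ⊞ L) := biprod.total
  rw [← HomologicalComplex.homologyMap_id, ← e, HomologicalComplex.homologyMap_add,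
    HomologicalComplex.homologyMap_comp, HomologicalComplex.homologyMap_comp,
    hK.eq_of_src (HomologicalComplex.homologyMap biprod.inl n) 0,
    hL.eq_of_src (HomologicalComplex.homologyMap biprod.inr n) 0]
  simp

end bi

theorem mv {Y : Type} [TopologicalSpace Y] {U V : Set Y} (hU : IsOpen U) (hV : IsOpen V)
    (hUV : U ∪ V = Set.univ) (i : ℕ)
    (hU0 : IsZero ((Hn i).obj (TopCat.of U))) (hU1 : IsZero ((Hn (i + 1)).obj (TopCat.of U)))
    (hV0 : IsZero ((Hn i).obj (TopCat.of V))) (hV1 : IsZero ((Hn (i + 1)).obj (TopCat.of V))) :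
    Nonempty ((Hn (i + 1)).obj (TopCat.of Y) ≅ (Hn i).obj (TopCat.of (U ∩ V : Set Y))) := by
  let j1 := chF.map (inc (Set.inter_subset_left : U ∩ V ⊆ U))
  let j2 := chF.map (inc (Set.inter_subset_right : U ∩ V ⊆ V))
  let f := biprod.lift j1 (-j2)
  let g := biprod.desc (chF.map (incl U)) (chF.map (incl V))
  have w : f ≫ g = 0 := by
    simp only [f, g, biprod.lift_desc, j1, j2, Preadditive.neg_comp, ← Functor.map_comp, inc_incl]
    simp
  have range_g : ∀ n (z : (chF.obj (TopCat.of Y)).X n), (∃ y, g.f n y = z) ↔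
      E (TopCat.of Y) n z ∈ Finsupp.supported ℤ ℤ (Sm U V (n + 1)) := by
    intro n z
    have hSm : Sm U V (n + 1) = {τ : C(D (n + 1), Y) | ∀ t, τ t ∈ U} ∪
      {τ : C(D (n + 1), Y) | ∀ t, τ t ∈ V} := rfl
    rw [hSm, Finsupp.supported_union, Submodule.mem_sup]
    constructor
    · rintro ⟨y, rfl⟩
      refine ⟨_, (range_incl U n _).1 ⟨(biprod.fst : chF.obj _ ⊞ chF.obj _ ⟶ _).f n y, rfl⟩, _,
        (range_incl V n _).1 ⟨(biprod.snd : chF.obj _ ⊞ chF.obj _ ⟶ _).f n y, rfl⟩, ?_⟩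
      rw [← map_add, desc_apply]
    · rintro ⟨a, ha, b, hb, hab⟩
      obtain ⟨a', ha'⟩ := (range_incl U n ((E (TopCat.of Y) n).symm a)).2
        (by rwa [LinearEquiv.apply_symm_apply])
      obtain ⟨b', hb'⟩ := (range_incl V n ((E (TopCat.of Y) n).symm b)).2
        (by rwa [LinearEquiv.apply_symm_apply])
      refine ⟨_, (desc_mk _ _ n a' b').trans ?_⟩
      rw [ha', hb', ← map_add, hab, LinearEquiv.symm_apply_apply]
  refine hom_lemma f g w ?_ ?_ ?_ i (isZero_biprod i hU0 hV0) (isZero_biprod (i + 1) hU1 hV1)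
  · intro n
    have : Function.Injective (j1.f n) := chF_inj _ (inc_inj _) n
    intro a b hab
    apply this
    have e : f ≫ biprod.fst = j1 := by simp [f]
    rw [← e]
    exact congrArg ((biprod.fst : chF.obj _ ⊞ chF.obj _ ⟶ _).f n) hab
  · intro n x hx
    have hx1 := (desc_apply _ _ n x).symm.trans hx
    set a := (biprod.fst : chF.obj (TopCat.of U) ⊞ chF.obj (TopCat.of V) ⟶ _).f n x with ha
    set b := (biprod.snd : chF.obj (TopCat.of U) ⊞ chF.obj (TopCat.of V) ⟶ _).f n x with hb
    have e1 : (chF.map (incl U)).f n a = (chF.map (incl V)).f n (-b) := by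
      rw [map_neg]; exact eq_neg_of_add_eq_zero_left hx1
    have s1 := (range_incl U n _).1 ⟨a, rfl⟩
    have s2 := (range_incl V n _).1 ⟨-b, rfl⟩
    rw [← e1] at s2
    have s3 : E (TopCat.of Y) n ((chF.map (incl U)).f n a) ∈
        Finsupp.supported ℤ ℤ {τ : C(D (n + 1), Y) | ∀ t, τ t ∈ U ∩ V} := by
      rw [Finsupp.mem_supported] at s1 s2 ⊢
      intro τ hτ t
      exact ⟨s1 hτ t, s2 hτ t⟩
    obtain ⟨c, hc⟩ := (range_incl (U ∩ V) n _).2 s3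
    refine ⟨c, ?_⟩
    have c1 : j1.f n c = a := by
      apply chF_inj (incl U) (incl_inj U) n
      rw [← hc]
      exact map_inc_incl _ n c
    have c2 : (-j2).f n c = b := by
      have : j2.f n c = -b := by
        apply chF_inj (incl V) (incl_inj V) n
        rw [← e1, ← hc]
        exact map_inc_incl _ n c
      have h2 : (-j2).f n c = -(j2.f n c) := rfl
      rw [h2, this, neg_neg]
    rw [lift_apply, c1, c2]
    exact inl_inr_apply n x
  · intro n z hz
    rw [range_g, E_d] at hz
    obtain ⟨t, ht⟩ := small_main hU hV hUV _ hz
    refine ⟨(E (TopCat.of Y) (n + 2)).symm t, (range_g (n + 1) _).2 ?_⟩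
    rw [map_sub, E_d, LinearEquiv.apply_symm_apply]
    exact ht

end
end SuspAux

namespace SuspAux
section
open Limits Topology
variable {X : Type} [TopologicalSpace X]

/-- quotient map -/
def mk (x : X) (t : I) : UnreducedSuspension X := Quotient.mk (suspSetoid X) (x, t)

lemma isQ : IsQuotientMap (fun p : X × I => mk p.1 p.2) :=
  isQuotientMap_quotient_mk'

lemma mk_cont : Continuous (fun p : X × I => mk p.1 p.2) := isQ.continuous

lemma mk_zero (x y : X) : mk x 0 = mk y 0 := Quotient.sound (Or.inr (Or.inl ⟨rfl, rfl⟩))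
lemma mk_one (x y : X) : mk x 1 = mk y 1 := Quotient.sound (Or.inr (Or.inr ⟨rfl, rfl⟩))

lemma mk_ind {P : UnreducedSuspension X → Prop} (h : ∀ x t, P (mk x t)) (y) : P y := by
  induction y using Quotient.inductionOn with
  | _ p => exact h p.1 p.2

/-- height -/
def hgt : UnreducedSuspension X → I :=
  Quotient.lift (fun p : X × I => p.2) (by
    rintro p q (rfl | ⟨h1, h2⟩ | ⟨h1, h2⟩)
    · rfl
    · exact h1.trans h2.symm
    · exact h1.trans h2.symm)

lemma hgt_mk (x : X) (t : I) : hgt (mk x t) = t := rfl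

lemma hgt_cont : Continuous (hgt : UnreducedSuspension X → I) :=
  continuous_snd.quotient_lift _

/-- convex combination -/
noncomputable def cc (s t u : I) : I := ⟨(1 - s) * t + s * u, by
  have h1 := s.2.1; have h2 := s.2.2; have h3 := t.2.1; have h4 := t.2.2
  have h5 := u.2.1; have h6 := u.2.2
  constructor <;> nlinarith⟩

lemma cc_zero (t u : I) : cc 0 t u = t := by ext; simp [cc]
lemma cc_one (t u : I) : cc 1 t u = u := by ext; simp [cc]
lemma cc_self (s t : I) : cc s t t = t := by ext; simp [cc]; ring

lemma cc_cont : Continuous (fun p : I × I × I => cc p.1 p.2.1 p.2.2) := by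
  unfold cc; fun_prop

/-- reparametrization homotopy -/
noncomputable def rep (h : C(I, I)) (h0 : h 0 = 0) (h1 : h 1 = 1) :
    UnreducedSuspension X → C(I, UnreducedSuspension X) :=
  Quotient.lift (fun p : X × I =>
    ContinuousMap.curry ⟨fun q : (X × I) × I => mk q.1.1 (cc q.2 q.1.2 (h q.1.2)),
      mk_cont.comp (Continuous.prodMk (by fun_prop)
        (cc_cont.comp (by fun_prop : Continuous fun q : (X × I) × I => (q.2, q.1.2, h q.1.2))))⟩ p) (by
    rintro ⟨x, t⟩ ⟨y, u⟩ (h | ⟨rfl, rfl⟩ | ⟨rfl, rfl⟩)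
    · rw [h]
    · ext s
      simp only [ContinuousMap.curry_apply, ContinuousMap.coe_mk, h0, cc_self]
      exact mk_zero _ _
    · ext s
      simp only [ContinuousMap.curry_apply, ContinuousMap.coe_mk, h1, cc_self]
      exact mk_one _ _)

lemma rep_mk (h : C(I, I)) (h0 : h 0 = 0) (h1 : h 1 = 1) (x : X) (t s : I) :
    rep h h0 h1 (mk x t) s = mk x (cc s t (h t)) := rfl

lemma rep_cont (h : C(I, I)) (h0 : h 0 = 0) (h1 : h 1 = 1) :
    Continuous (rep (X := X) h h0 h1) :=
  Continuous.quotient_lift (ContinuousMap.continuous _) _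

/-- restriction to a slab -/
noncomputable def hp (h : C(I, I)) (h0 : h 0 = 0) (h1 : h 1 = 1) (J : Set I)
    (hJ : ∀ s, ∀ t ∈ J, cc s t (h t) ∈ J)
    (g : C((hgt ⁻¹' J : Set (UnreducedSuspension X)), (hgt ⁻¹' J : Set (UnreducedSuspension X))))
    (hg : ∀ x t (ht : t ∈ J), (g ⟨mk x t, ht⟩).1 = mk x (h t)) :
    ContinuousMap.Homotopy (ContinuousMap.id _) g where
  toFun p := ⟨rep h h0 h1 p.2.1 p.1, by
    obtain ⟨s, y, hy⟩ := p
    induction y using mk_ind with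
    | _ x t => exact hJ s t hy⟩
  continuous_toFun := by
    have := rep_cont (X := X) h h0 h1
    refine Continuous.subtype_mk ?_ _
    fun_prop
  map_zero_left := by
    rintro ⟨y, hy⟩
    induction y using mk_ind with
    | _ x t => exact Subtype.ext ((rep_mk _ _ _ _ _ _).trans (by rw [cc_zero]; rfl))
  map_one_left := by
    rintro ⟨y, hy⟩
    induction y using mk_ind with
    | _ x t => exact Subtype.ext ((rep_mk _ _ _ _ _ _).trans (by rw [cc_one, hg x t hy]))

/-- lower part -/
def JU : Set I := {t | (t : ℝ) < 2 / 3}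
/-- upper part -/
def JV : Set I := {t | 1 / 3 < (t : ℝ)}

/-- lower reparametrization -/
noncomputable def hU : C(I, I) := ⟨fun t => ⟨max 0 (3 * t - 2), by
  have := t.2.2
  exact ⟨le_max_left _ _, max_le (by norm_num) (by linarith)⟩⟩, by fun_prop⟩

/-- upper reparametrization -/
noncomputable def hV : C(I, I) := ⟨fun t => ⟨min 1 (3 * t), by
  have := t.2.1
  exact ⟨le_min (by norm_num) (by linarith), min_le_left _ _⟩⟩, by fun_prop⟩

/-- middle reparametrization -/
noncomputable def hW : C(I, I) := ⟨fun t => ⟨max (min (3 * t / 2) (1 / 2)) (3 * t / 2 - 1 / 2), by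
  have := t.2.1
  have := t.2.2
  exact ⟨le_max_of_le_left (le_min (by linarith) (by norm_num)),
    max_le ((min_le_right _ _).trans (by norm_num)) (by linarith)⟩⟩, by fun_prop⟩

lemma hU_eq (t : I) (ht : t ∈ JU) : hU t = 0 := by
  have : (t : ℝ) < 2 / 3 := ht
  ext
  simp only [hU, ContinuousMap.coe_mk, Set.Icc.coe_zero]
  exact max_eq_left (by linarith)

lemma hV_eq (t : I) (ht : t ∈ JV) : hV t = 1 := by
  have : 1 / 3 < (t : ℝ) := ht
  ext
  simp only [hV, ContinuousMap.coe_mk, Set.Icc.coe_one]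
  exact min_eq_left (by linarith)

/-- midpoint -/
noncomputable def half : I := ⟨1 / 2, by norm_num, by norm_num⟩

lemma hW_eq (t : I) (ht : t ∈ JU ∩ JV) : hW t = half := by
  have h1 : (t : ℝ) < 2 / 3 := ht.1
  have h2 : 1 / 3 < (t : ℝ) := ht.2
  ext
  simp only [hW, ContinuousMap.coe_mk, half]
  rw [min_eq_right (by linarith), max_eq_left (by linarith)]

lemma cc_JU (s t u : I) (ht : t ∈ JU) (hu : u ∈ JU) : cc s t u ∈ JU := by
  have h1 : (t : ℝ) < 2 / 3 := ht
  have h2 : (u : ℝ) < 2 / 3 := hu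
  have := s.2.1
  have := s.2.2
  change (1 - (s : ℝ)) * t + s * u < 2 / 3
  rcases eq_or_lt_of_le s.2.2 with h | h
  · rw [h]; linarith
  · nlinarith [mul_lt_mul_of_pos_left h1 (sub_pos.2 h)]

lemma cc_JV (s t u : I) (ht : t ∈ JV) (hu : u ∈ JV) : cc s t u ∈ JV := by
  have h1 : 1 / 3 < (t : ℝ) := ht
  have h2 : 1 / 3 < (u : ℝ) := hu
  have := s.2.1
  have := s.2.2
  change 1 / 3 < (1 - (s : ℝ)) * t + s * u
  rcases eq_or_lt_of_le s.2.2 with h | h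
  · rw [h]; linarith
  · nlinarith [mul_lt_mul_of_pos_left h1 (sub_pos.2 h)]

lemma zero_JU : (0 : I) ∈ JU := by simp [JU]
lemma one_JV : (1 : I) ∈ JV := by simp [JV]; norm_num
lemma half_mem : half ∈ JU ∩ JV := by constructor <;> simp [JU, JV, half] <;> norm_num

lemma JU_open : IsOpen JU := isOpen_lt (by fun_prop) (by fun_prop)
lemma JV_open : IsOpen JV := isOpen_lt (by fun_prop) (by fun_prop)

lemma cover : (hgt ⁻¹' JU : Set (UnreducedSuspension X)) ∪ hgt ⁻¹' JV = Set.univ := by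
  rw [← Set.preimage_union]
  convert Set.preimage_univ
  ext t
  simp only [JU, JV, Set.mem_union, Set.mem_setOf_eq, Set.mem_univ, iff_true]
  by_contra! h
  linarith [h.1, h.2]

lemma zU (x₀ : X) (n : ℕ) (hn : n ≠ 0) :
    IsZero ((Hn n).obj (TopCat.of (hgt ⁻¹' JU : Set (UnreducedSuspension X)))) := by
  refine Hn_contr _ (⟨mk x₀ 0, zero_JU⟩ : (hgt ⁻¹' JU : Set (UnreducedSuspension X)))
    (hp hU (by ext; simp [hU]) (by ext; simp [hU]; norm_num) JU ?_ _ ?_) n hn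
  · intro s t ht
    exact cc_JU s t _ ht (by rw [hU_eq t ht]; exact zero_JU)
  · intro x t ht
    rw [hU_eq t ht]
    exact mk_zero _ _

lemma zV (x₀ : X) (n : ℕ) (hn : n ≠ 0) :
    IsZero ((Hn n).obj (TopCat.of (hgt ⁻¹' JV : Set (UnreducedSuspension X)))) := by
  refine Hn_contr _ (⟨mk x₀ 1, one_JV⟩ : (hgt ⁻¹' JV : Set (UnreducedSuspension X)))
    (hp hV (by ext; simp [hV]) (by ext; simp [hV]) JV ?_ _ ?_) n hn
  · intro s t ht
    exact cc_JV s t _ ht (by rw [hV_eq t ht]; exact one_JV)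
  · intro x t ht
    rw [hV_eq t ht]
    exact mk_one _ _

/-- slab -/
abbrev W (X : Type) [TopologicalSpace X] : Set (UnreducedSuspension X) := hgt ⁻¹' (JU ∩ JV)

/-- projection of the slab -/
noncomputable def rW (y : W X) : X := (Quotient.out y.1).1

lemma rW_mk (x : X) (t : I) (ht : t ∈ JU ∩ JV) : rW (⟨mk x t, ht⟩ : W X) = x := by
  have h1 : (t : ℝ) < 2 / 3 := ht.1
  have h2 : 1 / 3 < (t : ℝ) := ht.2
  have : (suspSetoid X).r (Quotient.out (mk x t)) (x, t) := Quotient.exact (Quotient.out_eq (mk x t))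
  rcases this with h | ⟨-, h⟩ | ⟨-, h⟩
  · exact congrArg Prod.fst h
  · have : t = 0 := h
    subst this; norm_num at h2
  · have : t = 1 := h
    subst this; norm_num at h1

lemma rW_cont : Continuous (rW : W X → X) := by
  have hW : IsOpen (W X) := (JU_open.inter JV_open).preimage hgt_cont
  have q := (isQ (X := X)).restrictPreimage_isOpen hW
  rw [q.continuous_iff]
  have : (rW : W X → X) ∘ (W X).restrictPreimage (fun p : X × I => mk p.1 p.2) =
      fun p => p.1.1 := by
    ext ⟨⟨x, t⟩, h⟩
    exact rW_mk x t h
  rw [this]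
  fun_prop

lemma eW (n : ℕ) : Nonempty ((Hn n).obj (TopCat.of (W X)) ≅ (Hn n).obj (TopCat.of X)) := by
  let q : C(X, W X) := ⟨fun x => ⟨mk x half, half_mem⟩,
    Continuous.subtype_mk (mk_cont.comp (by fun_prop : Continuous fun x : X => (x, half))) _⟩
  let p : C(W X, X) := ⟨rW, rW_cont⟩
  refine Hn_equiv (TopCat.ofHom p) (TopCat.ofHom q) ?_
    (hp hW (by ext; simp [hW]) (by ext; simp [hW]; norm_num) (JU ∩ JV) ?_ (q.comp p) ?_) n
  · ext x
    exact rW_mk x half half_mem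
  · intro s t ht
    rw [hW_eq t ht]
    exact ⟨cc_JU _ _ _ ht.1 half_mem.1, cc_JV _ _ _ ht.2 half_mem.2⟩
  · intro x t ht
    rw [hW_eq t ht]
    change mk (rW _) half = _
    rw [rW_mk]

theorem main (X : Type) [TopologicalSpace X] [Nonempty X] (i : ℕ) (hi : 1 ≤ i) :
    Nonempty (singularHomology (UnreducedSuspension X) (i + 1) ≅ singularHomology X i) := by
  obtain ⟨x₀⟩ := ‹Nonempty X›
  obtain ⟨e1⟩ := mv (JU_open.preimage (hgt_cont (X := X))) (JV_open.preimage hgt_cont) cover i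
    (zU x₀ i (by omega)) (zU x₀ (i + 1) (by omega)) (zV x₀ i (by omega)) (zV x₀ (i + 1) (by omega))
  obtain ⟨e2⟩ := eW (X := X) i
  exact ⟨e1 ≪≫ e2⟩

end
end SuspAux

/-- **Suspension isomorphism.** For every nonempty topological space `X` and every `i ≥ 1`,
the `(i+1)`-st singular homology group (with `ℤ` coefficients) of the unreduced suspension of
`X` is isomorphic to the `i`-th singular homology group of `X`. -/
theorem homology_suspension_iso (X : Type) [TopologicalSpace X] [Nonempty X]
    (i : ℕ) (hi : 1 ≤ i) :
    Nonempty (singularHomology (UnreducedSuspension X) (i + 1) ≅ singularHomology X i) := by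
  exact SuspAux.main X i hi
end

section
/- If X is a nonempty path-connected topological space, then the second homotopy group of the unreduced suspension ΣX (at any basepoint) is isomorphic to the abelianization of the fundamental group of X: π₂(ΣX) ≅ π₁(X)/[π₁(X), π₁(X)]. -/
open CategoryTheory unitInterval

namespace SuspPi

/-- Continuity criterion for maps into a path space. -/
lemma continuous_toPath {Z Y : Type*} [TopologicalSpace Z] [TopologicalSpace Y] {a b : Y}
    (f : Z → Path a b) (h : Continuous fun z : Z × I => f z.1 z.2) : Continuous f :=
  Path.continuous_uncurry_iff.1 h

/-- Continuous evaluation. -/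
lemma continuous_evalPath {Z Y : Type*} [TopologicalSpace Z] [TopologicalSpace Y] {a b : Y}
    (f : Z → Path a b) (g : Z → I) (hf : Continuous f) (hg : Continuous g) :
    Continuous fun z => f z (g z) :=
  (Path.continuous_uncurry_iff.2 hf).comp (continuous_id.prodMk hg)

/-- clamp to the unit interval -/
noncomputable abbrev cl (t : ℝ) : I := Set.projIcc (0 : ℝ) 1 zero_le_one t

lemma continuous_cl : Continuous cl := continuous_projIcc

lemma cl_coe (t : I) : cl (t : ℝ) = t := Set.projIcc_val zero_le_one t

lemma cl_of_le {t : ℝ} (h : t ≤ 0) : cl t = 0 := Set.projIcc_of_le_left _ h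

lemma cl_of_ge {t : ℝ} (h : 1 ≤ t) : cl t = 1 := Set.projIcc_of_right_le _ h

lemma coe_cl {t : ℝ} (h0 : 0 ≤ t) (h1 : t ≤ 1) : ((cl t : I) : ℝ) = t := by
  have := Set.projIcc_of_mem (zero_le_one' ℝ) ⟨h0, h1⟩
  simp [cl, this]

/-- Path spaces of contractible spaces are contractible. -/
lemma contractible_path {D : Type*} [TopologicalSpace D] [ContractibleSpace D] (a b : D) :
    ContractibleSpace (Path a b) := by
  obtain ⟨y, ⟨C⟩⟩ := id_nullhomotopic D
  have hC0 : ∀ d, C (0, d) = d := fun d => by simp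
  have hC1 : ∀ d, C (1, d) = y := fun d => by simp
  let β : I → I → I := fun τ t => cl ((τ : ℝ) * min (3 * (t : ℝ)) (3 * (1 - (t : ℝ))))
  let ρ : I → I → I := fun τ t => cl ((1 - τ : ℝ) * t + τ * cl (3 * (t : ℝ) - 1))
  have hβ : Continuous fun z : I × I => β z.1 z.2 := by
    apply continuous_cl.comp; fun_prop
  have hρ : Continuous fun z : I × I => ρ z.1 z.2 := by
    apply continuous_cl.comp
    have : Continuous fun z : I × I => ((cl (3 * (z.2 : ℝ) - 1) : I) : ℝ) :=
      continuous_subtype_val.comp (continuous_cl.comp (by fun_prop))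
    fun_prop
  let K : I × Path a b → Path a b := fun z =>
    { toFun := fun t => C (β z.1 t, z.2 (ρ z.1 t))
      continuous_toFun := by
        have h1 : Continuous fun t => β z.1 t := hβ.comp (by fun_prop : Continuous fun t => (z.1, t))
        have h2 : Continuous fun t => ρ z.1 t := hρ.comp (by fun_prop : Continuous fun t => (z.1, t))
        fun_prop
      source' := by
        have h1 : β z.1 0 = 0 := cl_of_le (by simp)
        have h2 : ρ z.1 0 = 0 := cl_of_le (by simp [cl_of_le])
        simp [h1, h2]
      target' := by
        have h1 : β z.1 1 = 0 := cl_of_le (by simp)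
        have h2 : ρ z.1 1 = 1 := cl_of_ge (by
          have : cl (3 - 1) = 1 := cl_of_ge (by norm_num)
          simp [this])
        simp [h1, h2] }
  have hK : Continuous K := by
    apply continuous_toPath
    change Continuous fun z : (I × Path a b) × I => C (β z.1.1 z.2, z.1.2 (ρ z.1.1 z.2))
    have h1 : Continuous fun z : (I × Path a b) × I => β z.1.1 z.2 :=
      hβ.comp (by fun_prop : Continuous fun z : (I × Path a b) × I => (z.1.1, z.2))
    have h2 : Continuous fun z : (I × Path a b) × I => ρ z.1.1 z.2 :=
      hρ.comp (by fun_prop : Continuous fun z : (I × Path a b) × I => (z.1.1, z.2))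
    have h3 := continuous_evalPath (fun z : (I × Path a b) × I => z.1.2) _ (by fun_prop) h2
    fun_prop
  obtain ⟨p0⟩ : Nonempty (Path a b) := ⟨(PathConnectedSpace.joined a b).some⟩
  rw [contractible_iff_id_nullhomotopic]
  refine ⟨K (1, p0), ⟨⟨⟨K, hK⟩, ?_, ?_⟩⟩⟩
  · intro p
    ext t
    change C (β 0 t, p (ρ 0 t)) = p t
    have h1 : β 0 t = 0 := cl_of_le (by simp)
    have h2 : ρ 0 t = t := by simp [ρ, cl_coe]
    rw [h1, h2, hC0]
  · intro p
    ext t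
    change C (β 1 t, p (ρ 1 t)) = C (β 1 t, p0 (ρ 1 t))
    have hr : ρ 1 t = cl (3 * (t : ℝ) - 1) := by simp [ρ, cl_coe]
    rcases le_total (t : ℝ) (1 / 3) with h | h
    · rw [hr, cl_of_le (by linarith)]; simp
    · rcases le_total (2 / 3) (t : ℝ) with h' | h'
      · rw [hr, cl_of_ge (by linarith)]; simp
      · have : β 1 t = 1 := cl_of_ge (by
          simp only [Set.Icc.coe_one, one_mul, le_min_iff]; constructor <;> linarith)
        rw [this, hC1, hC1]

variable {Y : Type*} [TopologicalSpace Y]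

/-- Corestrict a path. -/
def liftPath {D : Set Y} {a b : Y} (p : Path a b) (h : ∀ t, p t ∈ D) (ha : a ∈ D) (hb : b ∈ D) :
    Path (⟨a, ha⟩ : D) ⟨b, hb⟩ where
  toFun t := ⟨p t, h t⟩
  continuous_toFun := by fun_prop
  source' := by simp
  target' := by simp

/-- Include a path. -/
def inclPath {D : Set Y} {a b : Y} {ha : a ∈ D} {hb : b ∈ D} (p : Path (⟨a, ha⟩ : D) ⟨b, hb⟩) :
    Path a b := p.map continuous_subtype_val

lemma continuous_inclPath {D : Set Y} {a b : Y} {ha : a ∈ D} {hb : b ∈ D} :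
    Continuous (inclPath : Path (⟨a, ha⟩ : D) ⟨b, hb⟩ → Path a b) := by
  apply continuous_toPath
  change Continuous fun z : Path (⟨a, ha⟩ : D) ⟨b, hb⟩ × I => ((z.1 z.2 : D) : Y)
  exact continuous_subtype_val.comp
    (continuous_evalPath (fun z : Path (⟨a, ha⟩ : D) ⟨b, hb⟩ × I => z.1) _ (by fun_prop) (by fun_prop))

/-- lift a path of paths to a subset. -/
def liftPath2 {D : Set Y} {a b : Y} {p p' : Path a b} (H : Path p p') (h : ∀ s t, H s t ∈ D)
    (ha : a ∈ D) (hb : b ∈ D) (hp : ∀ t, p t ∈ D) (hp' : ∀ t, p' t ∈ D) :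
    Path (liftPath p hp ha hb) (liftPath p' hp' ha hb) where
  toFun s := liftPath (H s) (h s) ha hb
  continuous_toFun := by
    apply continuous_toPath
    change Continuous fun z : I × I => (⟨H z.1 z.2, h z.1 z.2⟩ : D)
    apply Continuous.subtype_mk
    exact continuous_evalPath (fun z : I × I => H z.1) _ (by fun_prop) (by fun_prop)
  source' := by ext t; simp [liftPath]
  target' := by ext t; simp [liftPath]

/-- Two paths in a contractible set are connected by a path of paths in the set. -/
lemma exists_fill {D : Set Y} [ContractibleSpace D] {a b : Y} (p p' : Path a b)
    (hp : ∀ t, p t ∈ D) (hp' : ∀ t, p' t ∈ D) : ∃ H : Path p p', ∀ s t, H s t ∈ D := by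
  have ha : a ∈ D := by simpa using hp 0
  have hb : b ∈ D := by simpa using hp 1
  haveI := contractible_path (⟨a, ha⟩ : D) ⟨b, hb⟩
  obtain ⟨K⟩ := PathConnectedSpace.joined (liftPath p hp ha hb) (liftPath p' hp' ha hb)
  exact ⟨(K.map continuous_inclPath).cast (by ext; rfl) (by ext; rfl), fun s t => (K s t).2⟩

/-- Uniqueness of fillings. -/
lemma fill_unique {D : Set Y} [ContractibleSpace D] {a b : Y} {p p' : Path a b}
    (H H' : Path p p') (h : ∀ s t, H s t ∈ D) (h' : ∀ s t, H' s t ∈ D) : H.Homotopic H' := by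
  have hp : ∀ t, p t ∈ D := fun t => by simpa using h 0 t
  have hp' : ∀ t, p' t ∈ D := fun t => by simpa using h 1 t
  have ha : a ∈ D := by simpa using hp 0
  have hb : b ∈ D := by simpa using hp 1
  haveI := contractible_path (⟨a, ha⟩ : D) ⟨b, hb⟩
  have := SimplyConnectedSpace.paths_homotopic (liftPath2 H h ha hb hp hp')
    (liftPath2 H' h' ha hb hp hp')
  exact this.map ⟨inclPath, continuous_inclPath⟩

end SuspPi

namespace SuspPi

section EH
variable {Y : Type*} [TopologicalSpace Y]

/-- Pointwise concatenation of paths of paths. -/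
noncomputable def hz {a b c : Y} {p q : Path a b} {p' q' : Path b c} (H : Path p q) (H' : Path p' q') :
    Path (p.trans p') (q.trans q') where
  toFun s := (H s).trans (H' s)
  continuous_toFun := by fun_prop
  source' := by simp
  target' := by simp

lemma hz_homotopic {a b c : Y} {p q : Path a b} {p' q' : Path b c} {H K : Path p q}
    {H' K' : Path p' q'} (h : H.Homotopic K) (h' : H'.Homotopic K') :
    (hz H H').Homotopic (hz K K') := by
  obtain ⟨F⟩ := h
  obtain ⟨F'⟩ := h'
  refine ⟨⟨⟨⟨fun z => (F z).trans (F' z), by fun_prop⟩, ?_, ?_⟩, ?_⟩⟩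
  · intro x; simp [hz]
  · intro x; simp [hz]
  · rintro t x (hx | hx)
    · subst hx; simp
    · rw [Set.mem_singleton_iff] at hx; subst hx; simp

lemma hz_trans {a b c : Y} {p q r : Path a b} {p' q' r' : Path b c} (H : Path p q) (K : Path q r)
    (H' : Path p' q') (K' : Path q' r') :
    hz (H.trans K) (H'.trans K') = (hz H H').trans (hz K K') := by
  ext s t
  change ((H.trans K s).trans (H'.trans K' s)) t = ((hz H H').trans (hz K K') s) t
  rw [Path.trans_apply H K, Path.trans_apply H' K', Path.trans_apply (hz H H') (hz K K')]
  split_ifs <;> rfl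

lemma hz_symm {a b c : Y} {p q : Path a b} {p' q' : Path b c} (H : Path p q) (H' : Path p' q') :
    hz H.symm H'.symm = (hz H H').symm := by
  ext s t
  simp [hz]

/-- the constant loop -/
abbrev ee (w : Y) : Path w w := Path.refl w

/-- horizontal product of double loops -/
noncomputable def hzz {w : Y} (g g' : Path (ee w) (ee w)) : Path (ee w) (ee w) :=
  (hz g g').cast Path.refl_trans_refl.symm Path.refl_trans_refl.symm

lemma hzz_homotopic {w : Y} {g g' k k' : Path (ee w) (ee w)} (h : g.Homotopic k)
    (h' : g'.Homotopic k') : (hzz g g').Homotopic (hzz k k') :=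
  (hz_homotopic h h').pathCast _ _

lemma hzz_trans {w : Y} (g g' k k' : Path (ee w) (ee w)) :
    hzz (g.trans k) (g'.trans k') = (hzz g g').trans (hzz k k') := by
  ext s t
  simp only [hzz, hz_trans, Path.cast_coe]
  simp only [Path.trans_apply]
  split_ifs <;> rfl

lemma hzz_refl_right {w : Y} (g : Path (ee w) (ee w)) :
    (hzz g (Path.refl _)).Homotopic g := by
  let f : I → I → I := fun τ t => cl ((1 - (τ : ℝ)) * cl (2 * (t : ℝ)) + τ * t)
  have hf : Continuous fun z : I × I => f z.1 z.2 := by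
    apply continuous_cl.comp
    have : Continuous fun z : I × I => ((cl (2 * (z.2 : ℝ)) : I) : ℝ) :=
      continuous_subtype_val.comp (continuous_cl.comp (by fun_prop))
    fun_prop
  have f0 : ∀ τ, f τ 0 = 0 := fun τ => cl_of_le (by simp [cl_of_le])
  have f1 : ∀ τ, f τ 1 = 1 := fun τ => cl_of_ge (by
    have : cl (2 * ((1 : I) : ℝ)) = 1 := cl_of_ge (by norm_num)
    rw [this]; simp)
  let K : I × I → Path w w := fun z =>
    { toFun := fun t => g z.2 (f z.1 t)
      continuous_toFun := by
        have : Continuous fun t => f z.1 t := hf.comp (by fun_prop : Continuous fun t => (z.1, t))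
        fun_prop
      source' := by simp [f0]
      target' := by simp [f1] }
  have hK : Continuous K := by
    apply continuous_toPath
    change Continuous fun z : (I × I) × I => g z.1.2 (f z.1.1 z.2)
    apply continuous_evalPath (fun z : (I × I) × I => g z.1.2) _ (by fun_prop)
    exact hf.comp (by fun_prop : Continuous fun z : (I × I) × I => (z.1.1, z.2))
  refine ⟨⟨⟨⟨K, hK⟩, ?_, ?_⟩, ?_⟩⟩
  · intro s
    ext t
    change g s (f 0 t) = ((g s).trans (Path.refl w)) t
    have : f 0 t = cl (2 * (t : ℝ)) := by simp [f]
    rw [this, Path.trans_apply]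
    split_ifs with h
    · congr 1
      exact Set.projIcc_of_mem _ _
    · rw [cl_of_ge (by linarith)]; simp
  · intro s
    ext t
    change g s (f 1 t) = g s t
    have : f 1 t = t := by simp [f]
    rw [this]
  · rintro τ s (hs | hs)
    · subst hs; ext t; change g 0 (f τ t) = hzz g (Path.refl _) 0 t; simp
    · rw [Set.mem_singleton_iff] at hs; subst hs; ext t
      change g 1 (f τ t) = hzz g (Path.refl _) 1 t; simp

lemma hzz_refl_left {w : Y} (g : Path (ee w) (ee w)) :
    (hzz (Path.refl _) g).Homotopic g := by
  let f : I → I → I := fun τ t => cl ((1 - (τ : ℝ)) * cl (2 * (t : ℝ) - 1) + τ * t)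
  have hf : Continuous fun z : I × I => f z.1 z.2 := by
    apply continuous_cl.comp
    have : Continuous fun z : I × I => ((cl (2 * (z.2 : ℝ) - 1) : I) : ℝ) :=
      continuous_subtype_val.comp (continuous_cl.comp (by fun_prop))
    fun_prop
  have f0 : ∀ τ, f τ 0 = 0 := fun τ => cl_of_le (by
    have : cl (2 * ((0 : I) : ℝ) - 1) = 0 := cl_of_le (by norm_num)
    rw [this]; simp)
  have f1 : ∀ τ, f τ 1 = 1 := fun τ => cl_of_ge (by
    have : cl (2 * ((1 : I) : ℝ) - 1) = 1 := cl_of_ge (by norm_num)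
    rw [this]; simp)
  let K : I × I → Path w w := fun z =>
    { toFun := fun t => g z.2 (f z.1 t)
      continuous_toFun := by
        have : Continuous fun t => f z.1 t := hf.comp (by fun_prop : Continuous fun t => (z.1, t))
        fun_prop
      source' := by simp [f0]
      target' := by simp [f1] }
  have hK : Continuous K := by
    apply continuous_toPath
    change Continuous fun z : (I × I) × I => g z.1.2 (f z.1.1 z.2)
    apply continuous_evalPath (fun z : (I × I) × I => g z.1.2) _ (by fun_prop)
    exact hf.comp (by fun_prop : Continuous fun z : (I × I) × I => (z.1.1, z.2))
  refine ⟨⟨⟨⟨K, hK⟩, ?_, ?_⟩, ?_⟩⟩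
  · intro s
    ext t
    change g s (f 0 t) = ((Path.refl w).trans (g s)) t
    have : f 0 t = cl (2 * (t : ℝ) - 1) := by simp [f]
    rw [this, Path.trans_apply]
    split_ifs with h
    · rw [cl_of_le (by linarith)]; simp
    · congr 1
      exact Set.projIcc_of_mem _ _
  · intro s
    ext t
    change g s (f 1 t) = g s t
    have : f 1 t = t := by simp [f]
    rw [this]
  · rintro τ s (hs | hs)
    · subst hs; ext t; change g 0 (f τ t) = hzz (Path.refl _) g 0 t; simp
    · rw [Set.mem_singleton_iff] at hs; subst hs; ext t
      change g 1 (f τ t) = hzz (Path.refl _) g 1 t; simp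

/-- Eckmann-Hilton -/
lemma hzz_eq_trans {w : Y} (g g' : Path (ee w) (ee w)) : (hzz g g').Homotopic (g.trans g') := by
  have h1 : (hzz g g').Homotopic (hzz (g.trans (Path.refl _)) ((Path.refl _).trans g')) :=
    hzz_homotopic ⟨(Path.Homotopy.transRefl g).symm⟩ ⟨(Path.Homotopy.reflTrans g').symm⟩
  rw [hzz_trans] at h1
  exact h1.trans ((hzz_refl_right g).hcomp (hzz_refl_left g'))

lemma hzz_eq_trans' {w : Y} (g g' : Path (ee w) (ee w)) : (hzz g g').Homotopic (g'.trans g) := by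
  have h1 : (hzz g g').Homotopic (hzz ((Path.refl _).trans g) (g'.trans (Path.refl _))) :=
    hzz_homotopic ⟨(Path.Homotopy.reflTrans g).symm⟩ ⟨(Path.Homotopy.transRefl g').symm⟩
  rw [hzz_trans] at h1
  exact h1.trans ((hzz_refl_left g').hcomp (hzz_refl_right g))

/-- the group of double loops is commutative -/
lemma BB_comm {w : Y} (a b : FundamentalGroup (Path w w) (ee w)) : a * b = b * a := by
  obtain ⟨g, rfl⟩ := Path.Homotopic.Quotient.mk_surjective a
  obtain ⟨k, rfl⟩ := Path.Homotopic.Quotient.mk_surjective b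
  exact Path.Homotopic.Quotient.eq.2 ((hzz_eq_trans k g).symm.trans (hzz_eq_trans' k g))

/-- transpose -/
def tp {w : Y} (g : Path (ee w) (ee w)) : Path (ee w) (ee w) where
  toFun t :=
    { toFun := fun s => g s t
      continuous_toFun := continuous_evalPath g _ (by fun_prop) (by fun_prop)
      source' := by simp
      target' := by simp }
  continuous_toFun := by
    apply continuous_toPath
    exact continuous_evalPath (fun z : I × I => g z.2) _ (by fun_prop) (by fun_prop)
  source' := by ext; simp
  target' := by ext; simp

@[simp] lemma tp_apply {w : Y} (g : Path (ee w) (ee w)) (s t : I) : tp g t s = g s t := rfl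

lemma tp_tp {w : Y} (g : Path (ee w) (ee w)) : tp (tp g) = g := by ext; rfl

lemma tp_trans {w : Y} (g k : Path (ee w) (ee w)) : tp (g.trans k) = hzz (tp g) (tp k) := by
  ext t s
  simp only [tp_apply, hzz, Path.cast_coe, hz, Path.coe_mk_mk, Path.trans_apply]
  split_ifs <;> rfl

lemma tp_homotopic {w : Y} {g k : Path (ee w) (ee w)} (h : g.Homotopic k) :
    (tp g).Homotopic (tp k) := by
  obtain ⟨F⟩ := h
  have hF : Continuous F := F.continuous
  refine ⟨⟨⟨⟨fun z => 
    { toFun := fun s => F (z.1, s) z.2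
      continuous_toFun := continuous_evalPath (fun s => F (z.1, s)) _ (by fun_prop) (by fun_prop)
      source' := by simp
      target' := by simp }, ?_⟩, ?_, ?_⟩, ?_⟩⟩
  · apply continuous_toPath
    exact continuous_evalPath (fun z : (I × I) × I => F (z.1.1, z.2)) _ (by fun_prop) (by fun_prop)
  · intro t; ext s; simp
  · intro t; ext s; simp
  · rintro τ t (ht | ht)
    · subst ht; ext s; simp
    · rw [Set.mem_singleton_iff] at ht; subst ht; ext s; simp

/-- transpose on classes -/
def sw {w : Y} : FundamentalGroup (Path w w) (ee w) → FundamentalGroup (Path w w) (ee w) :=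
  _root_.Quotient.map tp (fun _ _ h => tp_homotopic h)

lemma sw_mul {w : Y} (a b : FundamentalGroup (Path w w) (ee w)) : sw (a * b) = sw a * sw b := by
  obtain ⟨g, rfl⟩ := Path.Homotopic.Quotient.mk_surjective a
  obtain ⟨k, rfl⟩ := Path.Homotopic.Quotient.mk_surjective b
  change Path.Homotopic.Quotient.mk (tp (k.trans g)) = Path.Homotopic.Quotient.mk ((tp k).trans (tp g))
  rw [tp_trans]
  exact Path.Homotopic.Quotient.eq.2 (hzz_eq_trans _ _)

lemma sw_sw {w : Y} (a : FundamentalGroup (Path w w) (ee w)) : sw (sw a) = a := by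
  obtain ⟨g, rfl⟩ := Path.Homotopic.Quotient.mk_surjective a
  change Path.Homotopic.Quotient.mk (tp (tp g)) = Path.Homotopic.Quotient.mk g
  rw [tp_tp]

/-! ### the second homotopy group -/

/-- double loop to generalized loop -/
def toGen {w : Y} (g : Path (ee w) (ee w)) : GenLoop (Fin 2) Y w :=
  ⟨⟨fun v => g (v 0) (v 1), continuous_evalPath (fun v : Fin 2 → I => g (v 0)) _
    (by fun_prop) (by fun_prop)⟩, by
    rintro v ⟨i, hi⟩
    fin_cases i <;> rcases hi with hi | hi <;> simp at hi <;> simp [hi]⟩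

/-- generalized loop to double loop -/
def ofGen {w : Y} (f : GenLoop (Fin 2) Y w) : Path (ee w) (ee w) where
  toFun s :=
    { toFun := fun t => f ![s, t]
      continuous_toFun := f.1.continuous.comp (by fun_prop)
      source' := f.2 _ ⟨1, by simp⟩
      target' := f.2 _ ⟨1, by simp⟩ }
  continuous_toFun := by
    apply continuous_toPath
    exact f.1.continuous.comp (by fun_prop : Continuous fun z : I × I => ![z.1, z.2])
  source' := by ext t; exact f.2 _ ⟨0, by simp⟩
  target' := by ext t; exact f.2 _ ⟨0, by simp⟩

lemma toGen_ofGen {w : Y} (f : GenLoop (Fin 2) Y w) : toGen (ofGen f) = f := by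
  ext v
  change f ![v 0, v 1] = f v
  congr 1; ext i; fin_cases i <;> rfl

lemma ofGen_toGen {w : Y} (g : Path (ee w) (ee w)) : ofGen (toGen g) = g := by
  ext s t; rfl

lemma toGen_homotopic {w : Y} {g k : Path (ee w) (ee w)} (h : g.Homotopic k) :
    GenLoop.Homotopic (toGen g) (toGen k) := by
  obtain ⟨F⟩ := h
  have hF : Continuous F := F.continuous
  refine ⟨⟨⟨⟨fun z => F (z.1, z.2 0) (z.2 1), ?_⟩, ?_, ?_⟩, ?_⟩⟩
  · exact continuous_evalPath (fun z : I × (Fin 2 → I) => F (z.1, z.2 0)) _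
      (by fun_prop) (by fun_prop)
  · intro v; simp [toGen]
  · intro v; simp [toGen]
  · rintro τ v hv
    have : toGen g v = w := (toGen g).2 v hv
    change F (τ, v 0) (v 1) = toGen g v
    rw [this]
    obtain ⟨i, hi⟩ := hv
    fin_cases i <;> rcases hi with hi | hi <;> simp at hi <;> simp [hi]

lemma ofGen_homotopic {w : Y} {f f' : GenLoop (Fin 2) Y w} (h : GenLoop.Homotopic f f') :
    (ofGen f).Homotopic (ofGen f') := by
  obtain ⟨F⟩ := h
  have hF : Continuous F := F.continuous
  have hb : ∀ τ v, v ∈ Cube.boundary (Fin 2) → F (τ, v) = w := fun τ v hv =>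
    (F.eq_fst τ hv).trans (f.2 v hv)
  refine ⟨⟨⟨⟨fun z => 
    { toFun := fun t => F (z.1, ![z.2, t])
      continuous_toFun := by fun_prop
      source' := hb _ _ ⟨1, by simp⟩
      target' := hb _ _ ⟨1, by simp⟩ }, ?_⟩, ?_, ?_⟩, ?_⟩⟩
  · apply continuous_toPath
    change Continuous fun z : (I × I) × I => F (z.1.1, ![z.1.2, z.2])
    fun_prop
  · intro s; ext t; simp [ofGen]
  · intro s; ext t; simp [ofGen]
  · rintro τ s (ht | ht)
    · subst ht; ext t; simpa using hb τ _ ⟨0, by simp⟩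
    · rw [Set.mem_singleton_iff] at ht; subst ht; ext t; simpa using hb τ _ ⟨0, by simp⟩

lemma toGen_trans {w : Y} (g k : Path (ee w) (ee w)) :
    toGen (g.trans k) = GenLoop.transAt 0 (toGen g) (toGen k) := by
  ext v
  change (g.trans k) (v 0) (v 1) = if (v 0 : ℝ) ≤ 1 / 2
      then toGen g (Function.update v 0 <| Set.projIcc 0 1 zero_le_one (2 * v 0))
      else toGen k (Function.update v 0 <| Set.projIcc 0 1 zero_le_one (2 * v 0 - 1))
  rw [Path.trans_apply]
  split_ifs with h
  · have := Set.projIcc_of_mem (zero_le_one' ℝ) (x := 2 * (v 0 : ℝ)) (by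
      constructor <;> [have := (v 0).2.1; skip] <;> linarith)
    change _ = g (Function.update v 0 _ 0) (Function.update v 0 _ 1)
    simp [this]
  · have := Set.projIcc_of_mem (zero_le_one' ℝ) (x := 2 * (v 0 : ℝ) - 1) (by
      constructor <;> [skip; have := (v 0).2.2] <;> linarith)
    change _ = k (Function.update v 0 _ 0) (Function.update v 0 _ 1)
    simp [this]

/-- The second homotopy group is the fundamental group of the loop space. -/
noncomputable def pi2Equiv (w : Y) :
    FundamentalGroup (Path w w) (ee w) ≃* HomotopyGroup (Fin 2) Y w where
  toFun := _root_.Quotient.map toGen (fun _ _ h => toGen_homotopic h)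
  invFun := _root_.Quotient.map ofGen (fun _ _ h => ofGen_homotopic h)
  left_inv a := by
    obtain ⟨g, rfl⟩ := Path.Homotopic.Quotient.mk_surjective a
    change Path.Homotopic.Quotient.mk (ofGen (toGen g)) = Path.Homotopic.Quotient.mk g
    rw [ofGen_toGen]
  right_inv a := by
    induction a using _root_.Quotient.ind with | _ f =>
    change (⟦toGen (ofGen f)⟧ : HomotopyGroup (Fin 2) Y w) = ⟦f⟧
    rw [toGen_ofGen]
  map_mul' a b := by
    obtain ⟨g, rfl⟩ := Path.Homotopic.Quotient.mk_surjective a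
    obtain ⟨k, rfl⟩ := Path.Homotopic.Quotient.mk_surjective b
    have := HomotopyGroup.mul_spec (i := (0 : Fin 2)) (p := toGen g) (q := toGen k)
    refine Eq.trans ?_ this.symm
    rw [← toGen_trans]
    rfl

end EH
end SuspPi

namespace SuspPi

/-- grid point -/
noncomputable def gp (n i : ℕ) : I := cl ((i : ℝ) / n)

lemma gp_zero (n : ℕ) : gp n 0 = 0 := cl_of_le (by simp)

lemma gp_self {n : ℕ} (hn : 0 < n) : gp n n = 1 := cl_of_ge (by
  have : (n : ℝ) ≠ 0 := by positivity
  rw [div_self this])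

lemma coe_gp {n i : ℕ} (h : i ≤ n) : ((gp n i : I) : ℝ) = i / n := by
  apply coe_cl (by positivity)
  rcases Nat.eq_zero_or_pos n with h0 | h0
  · subst h0; simp
  · rw [div_le_one (by positivity)]; exact_mod_cast h

lemma gp_le (n i : ℕ) : gp n i ≤ gp n (i + 1) :=
  Set.monotone_projIcc zero_le_one (by push_cast; gcongr; linarith)

section van
variable {Z : Type*} [TopologicalSpace Z] {z0 : Z}

/-- class of a loop in the fundamental group -/
def fg (γ : Path z0 z0) : FundamentalGroup Z z0 := Path.Homotopic.Quotient.mk γ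

lemma fg_eq {p q : Path z0 z0} : fg p = fg q ↔ p.Homotopic q := Path.Homotopic.Quotient.eq

lemma fg_surj (a : FundamentalGroup Z z0) : ∃ p, fg p = a :=
  Path.Homotopic.Quotient.mk_surjective a

lemma fg_trans (p q : Path z0 z0) : fg (p.trans q) = fg q * fg p := rfl

lemma fg_symm (p : Path z0 z0) : fg p.symm = (fg p)⁻¹ := rfl

lemma fg_refl : fg (Path.refl z0) = 1 := rfl

lemma van (γ : Path z0 z0) (n : ℕ) (hn : 0 < n) (H : Subgroup (FundamentalGroup Z z0))
    (κ : ∀ i : ℕ, Path (γ (gp n i)) z0) (h0 : ∀ s, κ 0 s = z0) (h1 : ∀ s, κ n s = z0)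
    (h : ∀ i < n, fg (((κ i).symm.trans
      (γ.subpath (gp n i) (gp n (i + 1)))).trans (κ (i + 1))) ∈ H) :
    fg γ ∈ H := by
  have key : ∀ i ≤ n, fg
      (((γ.subpath 0 (gp n i)).cast γ.source.symm rfl).trans (κ i)) ∈ H := by
    intro i
    induction i with
    | zero =>
      intro _
      have : ((γ.subpath 0 (gp n 0)).cast γ.source.symm rfl).trans (κ 0) = Path.refl z0 := by
        ext s
        rw [Path.trans_apply]
        split_ifs
        · simp [Path.subpath, gp_zero]
        · rw [h0]; rfl
      rw [this]
      exact H.one_mem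
    | succ i ih =>
      intro hi
      have e : fg
          (((γ.subpath 0 (gp n (i + 1))).cast γ.source.symm rfl).trans (κ (i + 1))) =
          fg (((κ i).symm.trans
            (γ.subpath (gp n i) (gp n (i + 1)))).trans (κ (i + 1))) *
          fg
            (((γ.subpath 0 (gp n i)).cast γ.source.symm rfl).trans (κ i)) := by
        rw [FundamentalGroup.mul_def]
        unfold fg
        have e1 : Path.Homotopic.Quotient.mk ((γ.subpath 0 (gp n (i + 1))).cast γ.source.symm rfl) =
            (Path.Homotopic.Quotient.mk ((γ.subpath 0 (gp n i)).cast γ.source.symm rfl)).trans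
              (Path.Homotopic.Quotient.mk (γ.subpath (gp n i) (gp n (i + 1)))) := by
          rw [← Path.Homotopic.Quotient.mk_trans]
          apply Path.Homotopic.Quotient.eq.2
          exact (Path.Homotopic.symm ⟨Path.Homotopy.subpathTransSubpath γ 0 (gp n i) (gp n (i + 1))⟩).pathCast
            γ.source.symm rfl
        simp only [Path.Homotopic.Quotient.mk_trans, e1, Path.Homotopic.Quotient.mk_symm]
        simp only [Path.Homotopic.Quotient.trans_assoc]
        rw [← Path.Homotopic.Quotient.trans_assoc (Path.Homotopic.Quotient.mk (κ i)),
          Path.Homotopic.Quotient.trans_symm, Path.Homotopic.Quotient.refl_trans]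
      rw [e]
      exact H.mul_mem (h i (by omega)) (ih (by omega))
  have e := key n le_rfl
  have e2 : fg γ = fg
      (((γ.subpath 0 (gp n n)).cast γ.source.symm rfl).trans (κ n)) := by
    have hz : γ (gp n n) = z0 := by rw [gp_self hn]; exact γ.target
    have a1 : κ n = (Path.refl z0).cast hz rfl := by ext s; rw [h1]; rfl
    have a2 : ((γ.subpath 0 (gp n n)).cast γ.source.symm rfl).trans (κ n) =
        (γ.trans (Path.refl z0)) := by
      ext s
      rw [a1, Path.trans_apply, Path.trans_apply]
      split_ifs
      · simp [Path.subpath, gp_self hn]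
      · rfl
    rw [a2]
    exact Path.Homotopic.Quotient.eq.2 ⟨(Path.Homotopy.transRefl γ).symm⟩
  rw [e2]; exact e

end van
end SuspPi

namespace SuspPi

/-- A cover of a space by two open contractible sets with path connected intersection. -/
structure Cov (Y : Type*) [TopologicalSpace Y] (w : Y) where
  U : Bool → Set Y
  opn : ∀ b, IsOpen (U b)
  cov : ∀ y, ∃ b, y ∈ U b
  con : ∀ b, ContractibleSpace (U b)
  hw : ∀ b, w ∈ U b
  pc : ∀ y, (∀ b, y ∈ U b) → JoinedIn {y | ∀ b, y ∈ U b} y w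

namespace Cov
variable {Y : Type*} [TopologicalSpace Y] {w : Y} (C : Cov Y w)

/-- the intersection -/
def W : Set Y := {y | ∀ b, y ∈ C.U b}

lemma wW : w ∈ C.W := C.hw

lemma exists_tau (b : Bool) (η : Path w w) (h : ∀ t, η t ∈ C.U b) :
    ∃ H : Path (ee w) η, ∀ s t, H s t ∈ C.U b := by
  have := C.con b
  exact exists_fill _ _ (fun _ => C.hw b) h

/-- chosen filling -/
noncomputable def tau (b : Bool) (η : Path w w) (h : ∀ t, η t ∈ C.U b) : Path (ee w) η :=
  (C.exists_tau b η h).choose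

lemma tau_mem (b : Bool) (η : Path w w) (h : ∀ t, η t ∈ C.U b) (s t : I) :
    C.tau b η h s t ∈ C.U b := (C.exists_tau b η h).choose_spec s t

lemma tau_eq (b : Bool) (η : Path w w) (h : ∀ t, η t ∈ C.U b) (H : Path (ee w) η)
    (hH : ∀ s t, H s t ∈ C.U b) : (C.tau b η h).Homotopic H := by
  have := C.con b
  exact fill_unique _ _ (C.tau_mem b η h) hH

/-- the difference of the two fillings of a loop in the intersection -/
noncomputable def phi (η : Path w w) (h : ∀ t, η t ∈ C.W) : FundamentalGroup (Path w w) (ee w) :=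
  fg ((C.tau false η (fun t => h t _)).trans (C.tau true η (fun t => h t _)).symm)

lemma phi_eq (η : Path w w) (h : ∀ t, η t ∈ C.W) (H K : Path (ee w) η)
    (hH : ∀ s t, H s t ∈ C.U false) (hK : ∀ s t, K s t ∈ C.U true) :
    C.phi η h = fg (H.trans K.symm) :=
  fg_eq.2 ((C.tau_eq _ η _ H hH).hcomp (C.tau_eq _ η _ K hK).symm₂)

lemma trans_mem {a b c : Y} {D : Set Y} {p : Path a b} {q : Path b c} (hp : ∀ t, p t ∈ D)
    (hq : ∀ t, q t ∈ D) (t : I) : p.trans q t ∈ D := by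
  rw [Path.trans_apply]; split_ifs <;> [apply hp; apply hq]

lemma trans_mem2 {a b : Y} {D : Set Y} {p q r : Path a b} {H : Path p q} {K : Path q r}
    (hp : ∀ s t, H s t ∈ D) (hq : ∀ s t, K s t ∈ D) (s t : I) : H.trans K s t ∈ D := by
  rw [Path.trans_apply]; split_ifs <;> [apply hp; apply hq]

lemma phi_trans (η η' : Path w w) (h : ∀ t, η t ∈ C.W) (h' : ∀ t, η' t ∈ C.W) :
    C.phi (η.trans η') (trans_mem h h') = C.phi η h * C.phi η' h' := by
  let T : ∀ b, Path (ee w) (η.trans η') := fun b =>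
    (hz (C.tau b η (fun t => h t _)) (C.tau b η' (fun t => h' t _))).cast
      Path.refl_trans_refl.symm rfl
  have hT : ∀ b s t, T b s t ∈ C.U b := fun b s t =>
    trans_mem (C.tau_mem b η _ s) (C.tau_mem b η' _ s) t
  rw [C.phi_eq _ _ (T false) (T true) (hT _) (hT _), BB_comm]
  unfold phi
  rw [← fg_trans]
  refine fg_eq.2 (Path.Homotopic.trans ?_ (hzz_eq_trans _ _))
  have : (T false).trans (T true).symm = hzz
      ((C.tau false η (fun t => h t _)).trans (C.tau true η (fun t => h t _)).symm)
      ((C.tau false η' (fun t => h' t _)).trans (C.tau true η' (fun t => h' t _)).symm) := by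
    unfold hzz
    rw [hz_trans, hz_symm]
    ext s t
    rw [Path.cast_coe, Path.trans_apply, Path.trans_apply]
    split_ifs <;> rfl
  rw [this]

lemma phi_congr {η η' : Path w w} (h : ∀ t, η t ∈ C.W) (h' : ∀ t, η' t ∈ C.W)
    (K : Path η η') (hK : ∀ s t, K s t ∈ C.W) : C.phi η h = C.phi η' h' := by
  rw [C.phi_eq η' h' ((C.tau false η (fun t => h t _)).trans K)
    ((C.tau true η (fun t => h t _)).trans K)
    (trans_mem2 (C.tau_mem _ _ _) (fun s t => hK s t _))
    (trans_mem2 (C.tau_mem _ _ _) (fun s t => hK s t _))]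
  unfold phi fg
  rw [Path.trans_symm]
  simp only [Path.Homotopic.Quotient.mk_trans, Path.Homotopic.Quotient.mk_symm,
    Path.Homotopic.Quotient.trans_assoc]
  rw [← Path.Homotopic.Quotient.trans_assoc (Path.Homotopic.Quotient.mk K),
    Path.Homotopic.Quotient.trans_symm, Path.Homotopic.Quotient.refl_trans]

/-- base point of the intersection -/
abbrev w' : C.W := ⟨w, C.hw⟩

/-- include a loop -/
def inc (p : Path C.w' C.w') : Path w w := p.map continuous_subtype_val

lemma inc_mem (p : Path C.w' C.w') (t : I) : C.inc p t ∈ C.W := (p t).2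

lemma phi_inc_congr {p q : Path C.w' C.w'} (h : p.Homotopic q) :
    C.phi (C.inc p) (C.inc_mem p) = C.phi (C.inc q) (C.inc_mem q) := by
  obtain ⟨F⟩ := h
  let K : Path (C.inc p) (C.inc q) :=
    { toFun := fun s => C.inc (F.eval s)
      continuous_toFun := by
        apply continuous_toPath
        change Continuous fun z : I × I => ((F z : C.W) : Y)
        fun_prop
      source' := by simp
      target' := by simp }
  exact C.phi_congr _ _ K (fun s t => (F (s, t)).2)

lemma phi_refl (η : Path w w) (h : ∀ t, η t ∈ C.W) (hη : η = ee w) : C.phi η h = 1 := by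
  subst hη
  rw [C.phi_eq _ _ (Path.refl (ee w)) (Path.refl (ee w))
      (fun _ _ => C.hw _) (fun _ _ => C.hw _)]
  rw [fg_trans, fg_symm, fg_refl]; simp

/-- The homomorphism from the fundamental group of the intersection. -/
noncomputable def Phi : FundamentalGroup C.W C.w' →* FundamentalGroup (Path w w) (ee w) where
  toFun := _root_.Quotient.lift (fun p : Path C.w' C.w' => C.phi (C.inc p) (C.inc_mem p))
    (fun _ _ h => C.phi_inc_congr h)
  map_one' := C.phi_refl (C.inc (Path.refl _)) (C.inc_mem _) (by ext; rfl)
  map_mul' a b := by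
    obtain ⟨p, rfl⟩ := fg_surj a
    obtain ⟨q, rfl⟩ := fg_surj b
    rw [← fg_trans]
    change C.phi (C.inc (q.trans p)) _ = C.phi (C.inc p) _ * C.phi (C.inc q) _
    rw [BB_comm, ← C.phi_trans]
    congr 1
    exact Path.map_trans q p continuous_subtype_val

lemma Phi_fg (p : Path C.w' C.w') : C.Phi (fg p) = C.phi (C.inc p) (C.inc_mem p) := rfl

lemma phi_mem (η : Path w w) (h : ∀ t, η t ∈ C.W) : C.phi η h ∈ C.Phi.range :=
  ⟨fg (liftPath η h C.hw C.hw), rfl⟩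

end Cov
end SuspPi

namespace SuspPi
section rect
variable {Y : Type*} [TopologicalSpace Y] {w : Y}

lemma rectA (D : Set Y) (α P : I → Y) (hα : Continuous α) (hP : Continuous P) (h0 : α 0 = P 0)
    (h1 : α 1 = w) (hαD : ∀ r, α r ∈ D) (hPD : ∀ r, P r ∈ D) :
    ∃ K : I × I → Y, Continuous K ∧ (∀ u, K (0, u) = P u) ∧ (∀ u, K (1, u) = w) ∧
      (∀ r, K (r, 0) = α (cl (2 * (r : ℝ)))) ∧ (∀ z, K z ∈ D) := by
  let β : ℝ → Y := fun a => if a ≤ 0 then α (cl (-a)) else P (cl a)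
  have hβ : Continuous β := by
    apply Continuous.if_le
    · exact hα.comp (continuous_cl.comp (by fun_prop))
    · exact hP.comp continuous_cl
    · fun_prop
    · fun_prop
    · rintro a rfl; simp [cl_of_le, h0]
  have hβD : ∀ a, β a ∈ D := fun a => by
    simp only [β]; split_ifs <;> [apply hαD; apply hPD]
  have hβP : ∀ a, 0 ≤ a → β a = P (cl a) := by
    intro a ha
    simp only [β]
    split_ifs with h
    · have : a = 0 := le_antisymm h ha
      subst this; simp [cl_of_le, h0]
    · rfl
  refine ⟨fun z => β (z.2 - (cl (2 * (z.1 : ℝ)) : ℝ) * (1 + z.2)), ?_, ?_, ?_, ?_, fun z => hβD _⟩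
  · apply hβ.comp
    have : Continuous fun z : I × I => ((cl (2 * (z.1 : ℝ)) : I) : ℝ) :=
      continuous_subtype_val.comp (continuous_cl.comp (by fun_prop))
    fun_prop
  · intro u
    have : cl (2 * ((0 : I) : ℝ)) = 0 := cl_of_le (by simp)
    simp only [this]
    rw [hβP _ (by simpa using u.2.1)]; simp
  · intro u
    have : cl (2 * ((1 : I) : ℝ)) = 1 := cl_of_ge (by simp)
    simp only [this]
    have e : (u : ℝ) - ((1 : I) : ℝ) * (1 + u) = -1 := by simp
    rw [e]
    simp only [β]
    rw [if_pos (by norm_num), cl_of_ge (by norm_num), h1]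
  · intro r
    have e : ((0 : I) : ℝ) - (cl (2 * (r : ℝ)) : ℝ) * (1 + ((0 : I) : ℝ)) = - (cl (2 * (r : ℝ)) : ℝ) := by simp
    simp only [e]
    simp only [β]
    rw [if_pos (by simpa using (cl (2 * (r : ℝ))).2.1), neg_neg, cl_coe]

lemma rectB (D : Set Y) [ContractibleSpace D] (α P sg : I → Y) (hα : Continuous α)
    (hP : Continuous P) (hsg : Continuous sg) (h0 : α 0 = P 0)
    (h1 : α 1 = w) (hsg0 : sg 0 = P 1) (hsg1 : sg 1 = w)
    (hαD : ∀ r, α r ∈ D) (hPD : ∀ r, P r ∈ D) (hsgD : ∀ r, sg r ∈ D) :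
    ∃ K : I × I → Y, Continuous K ∧ (∀ u, K (0, u) = P u) ∧ (∀ u, K (1, u) = w) ∧
      (∀ r, K (r, 0) = α (cl (2 * (r : ℝ)))) ∧ (∀ z, K z ∈ D) ∧
      (∀ r, K (r, 1) = sg (cl (2 * (r : ℝ)))) := by
  let β : ℝ → Y := fun a => if a ≤ 0 then α (cl (-a)) else if a ≤ 1 then P (cl a) else sg (cl (a - 1))
  have hβ' : Continuous fun a : ℝ => if a ≤ 1 then P (cl a) else sg (cl (a - 1)) := by
    apply Continuous.if_le
    · exact hP.comp continuous_cl
    · exact hsg.comp (continuous_cl.comp (by fun_prop))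
    · fun_prop
    · fun_prop
    · rintro a rfl; simp [cl_of_le, cl_of_ge, hsg0]
  have hβ : Continuous β := by
    apply Continuous.if_le
    · exact hα.comp (continuous_cl.comp (by fun_prop))
    · exact hβ'
    · fun_prop
    · fun_prop
    · rintro a rfl; simp [cl_of_le, h0]
  have hβD : ∀ a, β a ∈ D := fun a => by
    simp only [β]; split_ifs <;> [apply hαD; apply hPD; apply hsgD]
  have hβα : ∀ a, a ≤ 0 → β a = α (cl (-a)) := fun a ha => if_pos ha
  have hβP : ∀ a, 0 ≤ a → a ≤ 1 → β a = P (cl a) := by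
    intro a ha ha'
    simp only [β]
    split_ifs with h
    · have : a = 0 := le_antisymm h ha
      subst this; simp [cl_of_le, h0]
    · rfl
  have hβsg : ∀ a, 1 ≤ a → β a = sg (cl (a - 1)) := by
    intro a ha
    simp only [β]
    rw [if_neg (by linarith)]
    split_ifs with h
    · have : a = 1 := le_antisymm h ha
      subst this; simp [cl_of_le, cl_of_ge, hsg0]
    · rfl
  let c : Path w w :=
    { toFun := fun t => β (3 * (t : ℝ) - 1)
      continuous_toFun := hβ.comp (by fun_prop)
      source' := by rw [hβα _ (by norm_num), cl_of_ge (by norm_num), h1]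
      target' := by rw [hβsg _ (by norm_num), cl_of_ge (by norm_num), hsg1] }
  have hwD : w ∈ D := h1 ▸ hαD 1
  obtain ⟨H, hH⟩ := exists_fill (D := D) c (ee w) (fun t => hβD _) (fun t => hwD)
  refine ⟨fun z => if (z.1 : ℝ) ≤ 1 / 2 then β (z.2 * (1 + 4 * z.1) - 2 * z.1)
    else H (cl (2 * (z.1 : ℝ) - 1)) z.2, ?_, ?_, ?_, ?_, ?_, ?_⟩
  · apply Continuous.if_le
    · exact hβ.comp (by fun_prop)
    · exact continuous_evalPath (fun z : I × I => H (cl (2 * (z.1 : ℝ) - 1))) _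
        (H.continuous.comp (continuous_cl.comp (by fun_prop))) (by fun_prop)
    · fun_prop
    · fun_prop
    · intro z hz
      rw [hz, cl_of_le (by norm_num), H.source]
      change _ = β _
      congr 1; ring
  · intro u
    simp only [Set.Icc.coe_zero]
    rw [if_pos (by norm_num), hβP _ (by simpa using u.2.1) (by simpa using u.2.2)]
    simp
  · intro u
    simp only [Set.Icc.coe_one]
    rw [if_neg (by norm_num), cl_of_ge (by norm_num), H.target]; rfl
  · intro r
    simp only [Set.Icc.coe_zero]
    split_ifs with h
    · rw [hβα _ (by have := r.2.1; linarith)]; congr 2; ring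
    · rw [cl_of_ge (by linarith : 1 ≤ 2 * (r : ℝ)), h1]; simp
  · intro z
    simp only
    split_ifs <;> [apply hβD; apply hH]
  · intro r
    simp only [Set.Icc.coe_one]
    split_ifs with h
    · rw [hβsg _ (by have := r.2.1; linarith)]; congr 2; ring
    · rw [cl_of_ge (by linarith : 1 ≤ 2 * (r : ℝ)), hsg1]; simp

end rect

namespace Cov
variable {Y : Type*} [TopologicalSpace Y] {w : Y} (C : Cov Y w)

lemma kappa_aux (n : ℕ) (l l' : ℕ → Bool) (hl : ∀ j, j + 1 = n → l j = l' j) (P : ℝ → Y)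
    (hP : Continuous P) (hP0 : ∀ t ≤ 0, P t = w) (hP1 : P n = w)
    (hPD : ∀ j < n, ∀ t : ℝ, j ≤ t → t ≤ j + 1 → P t ∈ C.U (l j) ∩ C.U (l' j)) :
    ∀ m ≤ n, ∃ k : I × ℝ → Y, Continuous k ∧ (∀ t ≤ (m : ℝ), k (0, t) = P t) ∧
      (∀ t, k (1, t) = w) ∧ (∀ r, ∀ t ≤ 0, k (r, t) = w) ∧
      (∀ j < m, ∀ r, ∀ t : ℝ, j ≤ t → t ≤ j + 1 → k (r, t) ∈ C.U (l j) ∩ C.U (l' j)) ∧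
      (∀ r, m < n → k (r, (m : ℝ)) ∈ C.U (l m) ∩ C.U (l' m)) ∧
      (∀ r, m = n → k (r, (m : ℝ)) = w) := by
  intro m
  induction m with
  | zero =>
    intro _
    refine ⟨fun _ => w, continuous_const, fun t ht => (hP0 t (by simpa using ht)).symm, ?_, ?_, ?_, ?_, ?_⟩
    · simp
    · simp
    · simp
    · intro _ _; exact ⟨C.hw _, C.hw _⟩
    · simp
  | succ m ih =>
    intro hm
    obtain ⟨k, hk, hk0, hk1, hkl, hkD, hkm, -⟩ := ih (by omega)
    -- the rectangle
    have rect : ∃ K : I × I → Y, Continuous K ∧ (∀ u : I, K (0, u) = P (m + u)) ∧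
        (∀ u, K (1, u) = w) ∧ (∀ r, K (r, 0) = k (cl (2 * (r : ℝ)), (m : ℝ))) ∧
        (∀ z, K z ∈ C.U (l m) ∩ C.U (l' m)) ∧
        (∀ r, m + 1 < n → K (r, 1) ∈ C.U (l (m + 1)) ∩ C.U (l' (m + 1))) ∧
        (∀ r, m + 1 = n → K (r, 1) = w) := by
      have a1 : Continuous fun r : I => k (r, (m : ℝ)) := by fun_prop
      have a2 : Continuous fun u : I => P (m + u) := by fun_prop
      have a3 : k ((0 : I), (m : ℝ)) = P (m + ((0 : I) : ℝ)) := by simp [hk0]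
      have a4 : ∀ u : I, P (m + u) ∈ C.U (l m) ∩ C.U (l' m) := fun u =>
        hPD m (by omega) _ (by simpa using u.2.1) (by simpa using u.2.2)
      by_cases hll : l m = l' m
      · have hD : C.U (l m) ∩ C.U (l' m) = C.U (l m) := by rw [← hll, Set.inter_self]
        have hs : ∃ sg : I → Y, Continuous sg ∧ sg 0 = P (m + ((1 : I) : ℝ)) ∧ sg 1 = w ∧
            (∀ r, sg r ∈ C.U (l m)) ∧
            (∀ r, m + 1 < n → sg r ∈ C.U (l (m + 1)) ∩ C.U (l' (m + 1))) ∧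
            (∀ r, m + 1 = n → sg r = w) := by
          by_cases hmn : m + 1 = n
          · refine ⟨fun _ => w, continuous_const, ?_, rfl, fun _ => C.hw _, by omega, fun _ _ => rfl⟩
            rw [← hP1, ← hmn]; simp
          · have hy : P (m + ((1 : I) : ℝ)) ∈ C.U (l m) := (a4 1).1
            have hy' := hPD (m + 1) (by omega) (m + ((1 : I) : ℝ)) (by simp) (by simp)
            by_cases hW : ∀ b, P (m + ((1 : I) : ℝ)) ∈ C.U b
            · obtain ⟨sg, hsg⟩ := C.pc _ hW
              exact ⟨sg, sg.continuous, sg.source, sg.target, fun r => hsg r _,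
                fun r _ => ⟨hsg r _, hsg r _⟩, by omega⟩
            · -- all labels agree
              have hb : ∀ b, P (m + ((1 : I) : ℝ)) ∈ C.U b → b = l m := by
                intro b hb
                by_contra hne
                apply hW
                intro b'
                by_cases h : b' = l m
                · rw [h]; exact hy
                · have : b' = b := by
                    revert hne h; cases b <;> cases b' <;> cases l m <;> simp
                  rw [this]; exact hb
              have e1 := hb _ hy'.1
              have e2 := hb _ hy'.2
              have := C.con (l m)
              obtain ⟨sg⟩ := PathConnectedSpace.joined (⟨_, hy⟩ : C.U (l m)) ⟨w, C.hw _⟩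
              refine ⟨fun r => (sg r : Y), by fun_prop, by simp, by simp, fun r => (sg r).2, ?_, by omega⟩
              intro r _
              rw [e1, e2, Set.inter_self]
              exact (sg r).2
        obtain ⟨sg, hsg, hsg0, hsg1, hsgD, hsgD', hsgw⟩ := hs
        have := C.con (l m)
        obtain ⟨K, hK, hK0, hK1, hKl, hKD, hKr⟩ := rectB (C.U (l m)) _ _ sg a1 a2 hsg a3 (hk1 _)
          hsg0 hsg1 (fun r => (hkm r (by omega)).1) (fun u => (a4 u).1) hsgD
        refine ⟨K, hK, hK0, hK1, hKl, fun z => by rw [hD]; exact hKD z, ?_, ?_⟩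
        · intro r h; rw [hKr]; exact hsgD' _ h
        · intro r h; rw [hKr]; exact hsgw _ h
      · obtain ⟨K, hK, hK0, hK1, hKl, hKD⟩ := rectA (C.U (l m) ∩ C.U (l' m)) _ _ a1 a2 a3 (hk1 _)
          (fun r => (hkm r (by omega))) a4
        refine ⟨K, hK, hK0, hK1, hKl, hKD, ?_, fun r h => absurd (hl m h) hll⟩
        intro r h
        have h2 : ∀ b, K (r, 1) ∈ C.U b := by
          intro b
          have := hKD (r, 1)
          by_cases hb : b = l m
          · rw [hb]; exact this.1
          · have : b = l' m := by
              revert hb hll; cases b <;> cases l m <;> cases l' m <;> simp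
            rw [this]; exact (hKD (r, 1)).2
        exact ⟨h2 _, h2 _⟩
    obtain ⟨K, hK, hK0, hK1, hKl, hKD, hKr, hKw⟩ := rect
    let k' : I × ℝ → Y := fun z => if z.2 ≤ m then k (cl (2 * (z.1 : ℝ)), z.2) else K (z.1, cl (z.2 - m))
    have hk'1 : ∀ r, ∀ t : ℝ, t ≤ m → k' (r, t) = k (cl (2 * (r : ℝ)), t) := fun r t h => if_pos h
    have hk'2 : ∀ r, ∀ t : ℝ, m ≤ t → k' (r, t) = K (r, cl (t - m)) := by
      intro r t h
      simp only [k']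
      split_ifs with h'
      · have : t = m := le_antisymm h' h
        subst this; simp [cl_of_le, hKl]
      · rfl
    refine ⟨k', ?_, ?_, ?_, ?_, ?_, ?_, ?_⟩
    · apply Continuous.if_le
      · apply hk.comp
        exact (continuous_cl.comp (by fun_prop)).prodMk (by fun_prop)
      · apply hK.comp
        exact continuous_fst.prodMk (continuous_cl.comp (by fun_prop))
      · fun_prop
      · fun_prop
      · intro z hz
        rw [hz]; simp [cl_of_le, hKl]
    · intro t ht
      rcases le_total t m with h | h
      · rw [hk'1 _ _ h, cl_of_le (by simp), hk0 _ h]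
      · rw [hk'2 _ _ h, hK0, coe_cl (by linarith) (by push_cast at ht; linarith)]; congr 1; ring
    · intro t
      rcases le_total t m with h | h
      · rw [hk'1 _ _ h, cl_of_ge (by simp), hk1]
      · rw [hk'2 _ _ h, hK1]
    · intro r t ht
      rw [hk'1 _ _ (ht.trans (by positivity)), hkl _ _ ht]
    · intro j hj r t h1 h2
      rcases Nat.lt_succ_iff_lt_or_eq.1 hj with h | h
      · have : (j : ℝ) + 1 ≤ m := by exact_mod_cast h
        rw [hk'1 _ _ (by linarith)]; exact hkD j h _ _ h1 h2
      · subst h; rw [hk'2 _ _ h1]; exact hKD _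
    · intro r h
      rw [hk'2 _ _ (by push_cast; linarith)]
      have : cl (((m + 1 : ℕ) : ℝ) - m) = 1 := cl_of_ge (by push_cast; linarith)
      rw [this]; exact hKr r h
    · intro r h
      rw [hk'2 _ _ (by push_cast; linarith)]
      have : cl (((m + 1 : ℕ) : ℝ) - m) = 1 := cl_of_ge (by push_cast; linarith)
      rw [this]; exact hKw r h

lemma kappa (n : ℕ) (hn : 0 < n) (l l' : ℕ → Bool) (hl : ∀ j, j + 1 = n → l j = l' j)
    (p : Path w w)
    (hp : ∀ j < n, ∀ t ∈ Set.Icc (gp n j) (gp n (j + 1)), p t ∈ C.U (l j) ∩ C.U (l' j)) :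
    ∃ κ : Path p (ee w), ∀ j < n, ∀ r, ∀ t ∈ Set.Icc (gp n j) (gp n (j + 1)),
      κ r t ∈ C.U (l j) ∩ C.U (l' j) := by
  have hn' : (0 : ℝ) < n := by exact_mod_cast hn
  obtain ⟨k, hk, hk0, hk1, hkl, hkD, -, hkw⟩ := C.kappa_aux n l l' hl (fun t => p (cl (t / n)))
    (p.continuous.comp (continuous_cl.comp (by fun_prop)))
    (fun t ht => by rw [cl_of_le (div_nonpos_of_nonpos_of_nonneg ht hn'.le)]; simp)
    (by rw [cl_of_ge (by rw [div_self hn'.ne'])]; simp)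
    (fun j hj t h1 h2 => hp j hj _ ⟨Set.monotone_projIcc zero_le_one (by gcongr),
      Set.monotone_projIcc zero_le_one (by push_cast; gcongr)⟩) n le_rfl
  refine ⟨⟨⟨fun r => ⟨⟨fun t => k (r, n * (t : ℝ)), by fun_prop⟩, ?_, ?_⟩, ?_⟩, ?_, ?_⟩, ?_⟩
  · simp [hkl]
  · simp [hkw]
  · apply continuous_toPath
    change Continuous fun z : I × I => k (z.1, n * (z.2 : ℝ))
    fun_prop
  · ext t
    change k (0, n * (t : ℝ)) = p t
    rw [hk0 _ (by have := t.2.2; nlinarith), mul_div_cancel_left₀ _ hn'.ne', cl_coe]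
  · ext t
    exact hk1 _
  · intro j hj r t ht
    have h1 : (gp n j : ℝ) ≤ t := ht.1
    have h2 : (t : ℝ) ≤ gp n (j + 1) := ht.2
    rw [coe_gp (by omega)] at h1 h2
    rw [div_le_iff₀ hn'] at h1
    rw [le_div_iff₀ hn'] at h2
    push_cast at h2
    exact hkD j hj _ _ (by linarith) (by linarith)

end Cov
end SuspPi

namespace SuspPi

lemma grid3 (O : Bool → Set (I × I × I)) (ho : ∀ b, IsOpen (O b)) (hc : ∀ z, ∃ b, z ∈ O b) :
    ∃ N : ℕ, ∀ n > N, ∃ l : ℕ → ℕ → ℕ → Bool, ∀ i < n, ∀ j < n, ∀ k < n, ∀ x y z : I,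
      x ∈ Set.Icc (gp n i) (gp n (i + 1)) → y ∈ Set.Icc (gp n j) (gp n (j + 1)) →
      z ∈ Set.Icc (gp n k) (gp n (k + 1)) → (x, y, z) ∈ O (l i j k) := by
  obtain ⟨δ, hδ, h⟩ := lebesgue_number_lemma_of_metric (isCompact_univ (X := I × I × I)) ho
    (fun z _ => by simpa using hc z)
  obtain ⟨N, hN⟩ := exists_nat_gt (1 / δ)
  refine ⟨N, fun n hn => ?_⟩
  have hn' : (0 : ℝ) < n := by exact_mod_cast (by omega : 0 < n)
  have hd : (1 : ℝ) / n < δ := by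
    rw [div_lt_iff₀ hn']
    rw [div_lt_iff₀ hδ] at hN
    have : (N : ℝ) < n := by exact_mod_cast hn
    nlinarith
  choose l hl using fun i j k : ℕ => h (gp n i, gp n j, gp n k) trivial
  refine ⟨l, fun i hi j hj k hk x y z hx hy hz => hl i j k ?_⟩
  have key : ∀ m < n, ∀ x : I, x ∈ Set.Icc (gp n m) (gp n (m + 1)) → dist x (gp n m) < δ := by
    intro m hm x hx
    refine lt_of_le_of_lt ?_ hd
    have h1 : (gp n m : ℝ) ≤ x := hx.1
    have h2 : (x : ℝ) ≤ gp n (m + 1) := hx.2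
    rw [coe_gp (by omega)] at h1 h2
    rw [Subtype.dist_eq, Real.dist_eq, coe_gp (by omega), abs_of_nonneg (by linarith)]
    push_cast at h2
    rw [add_div] at h2
    linarith
  rw [Metric.mem_ball, Prod.dist_eq, Prod.dist_eq, max_lt_iff, max_lt_iff]
  exact ⟨key i hi x hx, key j hj y hy, key k hk z hz⟩

lemma gp_ge {n i : ℕ} (hn : 0 < n) (h : n ≤ i) : gp n i = 1 := cl_of_ge (by
  rw [le_div_iff₀ (by exact_mod_cast hn), one_mul]; exact_mod_cast h)

lemma subpath_mem {Z : Type*} [TopologicalSpace Z] {a b : Z} (γ : Path a b) (n i : ℕ) (s : I) :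
    ∃ u ∈ Set.Icc (gp n i) (gp n (i + 1)), γ.subpath (gp n i) (gp n (i + 1)) s = γ u := by
  have : γ.subpath (gp n i) (gp n (i + 1)) s ∈ Set.range (γ.subpath (gp n i) (gp n (i + 1))) := ⟨s, rfl⟩
  rw [Path.range_subpath_of_le _ _ _ (gp_le n i)] at this
  obtain ⟨u, hu, h⟩ := this
  exact ⟨u, hu, h.symm⟩

/-- the transposition as a homomorphism -/
noncomputable def swHom {Y : Type*} [TopologicalSpace Y] (w : Y) :
    FundamentalGroup (Path w w) (ee w) →* FundamentalGroup (Path w w) (ee w) :=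
  MonoidHom.mk' sw sw_mul

namespace Cov
variable {Y : Type*} [TopologicalSpace Y] {w : Y} (C : Cov Y w)

lemma two_fill (b b' : Bool) (η : Path w w) (A A' : Path (ee w) η) (hA : ∀ s t, A s t ∈ C.U b)
    (hA' : ∀ s t, A' s t ∈ C.U b') : fg (A.trans A'.symm) ∈ C.Phi.range := by
  have hb : ∀ t, η t ∈ C.U b := fun t => by simpa using hA 1 t
  have hb' : ∀ t, η t ∈ C.U b' := fun t => by simpa using hA' 1 t
  by_cases h : b = b'
  · subst h
    have := C.con b
    have e : fg (A.trans A'.symm) = fg (A.trans A.symm) :=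
      fg_eq.2 ((Path.Homotopic.refl A).hcomp (fill_unique _ _ hA' hA).symm₂)
    have e2 : fg (A.trans A.symm) = 1 := by
      unfold fg
      rw [Path.Homotopic.Quotient.mk_trans, Path.Homotopic.Quotient.mk_symm,
        Path.Homotopic.Quotient.trans_symm]; rfl
    rw [e, e2]; exact one_mem _
  · have hW : ∀ t, η t ∈ C.W := by
      intro t c
      have h1 := hb t
      have h2 := hb' t
      revert h1 h2 h
      cases b <;> cases b' <;> cases c <;> simp +contextual
    cases b <;> cases b'
    · exact absurd rfl h
    · rw [← C.phi_eq η hW A A' hA hA']; exact C.phi_mem _ _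
    · have : fg (A.trans A'.symm) = (fg (A'.trans A.symm))⁻¹ := by
        rw [← fg_symm, Path.trans_symm, Path.symm_symm]
      rw [this, ← C.phi_eq η hW A' A hA' hA]; exact inv_mem (C.phi_mem _ _)
    · exact absurd rfl h

lemma strip (n : ℕ) (hn : 0 < n) (l : ℕ → Bool) (γ : Path (ee w) (ee w))
    (h : ∀ j < n, ∀ t ∈ Set.Icc (gp n j) (gp n (j + 1)), ∀ s, γ t s ∈ C.U (l j)) :
    fg γ ∈ C.Phi.range := by
  have hκ : ∀ j, ∃ κ : Path (γ (gp n j)) (ee w), (j = 0 ∨ j = n → ∀ s, κ s = ee w) ∧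
      (∃ b, ∀ r s, κ r s ∈ C.U b) ∧ ∀ j', j' + 1 = j → j' < n → ∀ r s, κ r s ∈ C.U (l j') := by
    intro j
    by_cases hj : j = 0 ∨ n ≤ j
    · have e : γ (gp n j) = ee w := by
        rcases hj with rfl | hj
        · rw [gp_zero]; exact γ.source
        · rw [gp_ge hn hj]; exact γ.target
      exact ⟨(Path.refl (ee w)).cast e rfl, fun _ _ => rfl, ⟨false, fun _ _ => C.hw _⟩,
        fun _ _ _ _ _ => C.hw _⟩
    · push Not at hj
      obtain ⟨m, rfl⟩ := Nat.exists_eq_succ_of_ne_zero hj.1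
      have hm : ∀ s, γ (gp n (m + 1)) s ∈ C.U (l m) := h m (by omega) _ ⟨gp_le _ _, le_rfl⟩
      refine ⟨(C.tau (l m) _ hm).symm, by omega, ⟨l m, fun r s => C.tau_mem _ _ _ _ _⟩, ?_⟩
      intro j' e _ r s
      obtain rfl : j' = m := by omega
      exact C.tau_mem _ _ _ _ _
  choose κ hκ1 hκ2 hκ3 using hκ
  refine van γ n hn _ κ (hκ1 0 (Or.inl rfl)) (hκ1 n (Or.inr rfl)) ?_
  intro j hj
  obtain ⟨b, hb⟩ := hκ2 j
  have key := C.two_fill b (l j) _ (κ j).symm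
    ((γ.subpath (gp n j) (gp n (j + 1))).trans (κ (j + 1))).symm
    (fun s t => hb _ _) (fun s t => trans_mem2 (fun s t => by
      obtain ⟨u, hu, e⟩ := subpath_mem γ n j s
      rw [e]; exact h j hj u hu t) (hκ3 (j + 1) j rfl hj) _ _)
  rw [Path.symm_symm] at key
  have e : fg (((κ j).symm.trans (γ.subpath (gp n j) (gp n (j + 1)))).trans (κ (j + 1))) =
      fg ((κ j).symm.trans ((γ.subpath (gp n j) (gp n (j + 1))).trans (κ (j + 1)))) := by
    unfold fg
    simp only [Path.Homotopic.Quotient.mk_trans, Path.Homotopic.Quotient.trans_assoc]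
  rw [e]; exact key

theorem Phi_surjective : Function.Surjective C.Phi := by
  have key : ∀ a : FundamentalGroup (Path w w) (ee w), sw a ∈ C.Phi.range := by
    intro a
    obtain ⟨g, rfl⟩ := fg_surj a
    have hg : Continuous fun z : I × I × I => g z.1 z.2.1 :=
      continuous_evalPath (fun z : I × I × I => g z.1) _ (by fun_prop) (by fun_prop)
    let O : Bool → Set (I × I × I) := fun b => {z | g z.1 z.2.1 ∈ C.U b ∧ (b = true → z.2.1 < 1)}
    have hO : ∀ b, IsOpen (O b) := by
      intro b
      have h2 : IsOpen {z : I × I × I | b = true → z.2.1 < 1} := ?_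
      · exact IsOpen.inter ((C.opn b).preimage hg) h2
      cases b
      · simp
      · simpa using isOpen_lt (by fun_prop : Continuous fun z : I × I × I => z.2.1) continuous_const
    have hOc : ∀ z, ∃ b, z ∈ O b := by
      intro z
      by_cases hz : z.2.1 = 1
      · refine ⟨false, ?_, by simp⟩
        rw [hz, (g z.1).target]; exact C.hw _
      · obtain ⟨b, hb⟩ := C.cov (g z.1 z.2.1)
        exact ⟨b, hb, fun _ => lt_of_le_of_ne le_one' hz⟩
    obtain ⟨N, hN⟩ := grid3 O hO hOc
    obtain ⟨l', hl'⟩ := hN (N + 1) (by omega)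
    generalize hnN : N + 1 = n at hl'
    have hn : 0 < n := by omega
    let l : ℕ → ℕ → Bool := fun i j => l' i j 0
    have hl : ∀ i < n, ∀ j < n, ∀ s ∈ Set.Icc (gp n i) (gp n (i + 1)),
        ∀ t ∈ Set.Icc (gp n j) (gp n (j + 1)), g s t ∈ C.U (l i j) := fun i hi j hj s hs t ht =>
      (hl' i hi j hj 0 hn s t (gp n 0) hs ht ⟨le_rfl, gp_le _ _⟩).1
    have hltop : ∀ i < n, ∀ j, j + 1 = n → l i j = false := by
      intro i hi j hj
      by_contra hc
      have := (hl' i hi j (by omega) 0 hn (gp n i) (gp n (j + 1)) (gp n 0) ⟨le_rfl, gp_le _ _⟩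
        ⟨gp_le _ _, le_rfl⟩ ⟨le_rfl, gp_le _ _⟩).2 (by simpa [l] using hc)
      simp only [hj, gp_self hn, lt_irrefl] at this
    have hκ : ∀ i, ∃ κ : Path (g (gp n i)) (ee w), (i = 0 ∨ i = n → ∀ s, κ s = ee w) ∧
        ∀ j < n, ∀ r, ∀ t ∈ Set.Icc (gp n j) (gp n (j + 1)), (i < n → κ r t ∈ C.U (l i j)) ∧
          ∀ i', i' + 1 = i → i' < n → κ r t ∈ C.U (l i' j) := by
      intro i
      by_cases hi : i = 0 ∨ n ≤ i
      · have e : g (gp n i) = ee w := by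
          rcases hi with rfl | hi
          · rw [gp_zero]; exact g.source
          · rw [gp_ge hn hi]; exact g.target
        exact ⟨(Path.refl (ee w)).cast e rfl, fun _ _ => rfl,
          fun _ _ _ _ _ => ⟨fun _ => C.hw _, fun _ _ _ => C.hw _⟩⟩
      · push Not at hi
        obtain ⟨m, rfl⟩ := Nat.exists_eq_succ_of_ne_zero hi.1
        obtain ⟨κ, hκ⟩ := C.kappa n hn (l m) (l (m + 1))
          (fun j hj => by rw [hltop _ (by omega) _ hj, hltop _ (by omega) _ hj]) (g (gp n (m + 1)))
          (fun j hj t ht => ⟨hl m (by omega) j hj _ ⟨gp_le _ _, le_rfl⟩ t ht,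
            hl (m + 1) (by omega) j hj _ ⟨le_rfl, gp_le _ _⟩ t ht⟩)
        refine ⟨κ, by omega, fun j hj r t ht => ⟨fun _ => (hκ j hj r t ht).2, ?_⟩⟩
        intro i' e _
        obtain rfl : i' = m := by omega
        exact (hκ j hj r t ht).1
    choose κ hκ1 hκ2 using hκ
    have : fg g ∈ C.Phi.range.comap (swHom w) := by
      refine van g n hn _ κ (hκ1 0 (Or.inl rfl)) (hκ1 n (Or.inr rfl)) ?_
      intro i hi
      change fg (tp _) ∈ C.Phi.range
      refine C.strip n hn (l i) _ ?_
      intro j hj t ht s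
      rw [tp_apply, Path.trans_apply]
      split_ifs
      · rw [Path.trans_apply]
        split_ifs
        · exact (hκ2 i j hj _ t ht).1 hi
        · obtain ⟨u, hu, e⟩ := subpath_mem g n i ⟨2 * (2 * (s : ℝ)) - 1, _⟩
          rw [e]; exact hl i hi j hj u hu t ht
      · exact (hκ2 (i + 1) j hj _ t ht).2 i rfl hi
    exact this
  intro a
  have := key (sw a)
  rw [sw_sw] at this
  exact this

end Cov
end SuspPi

namespace SuspPi

section comb
variable {A : Type*} [AddCommGroup A]

/-- indicator -/
def ind (b : Bool) (x : A) : A := if b then x else 0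

lemma ind_sub (b : Bool) (x y : A) : ind b (x - y) = ind b x - ind b y := by
  cases b <;> simp [ind]

lemma ind_add (b : Bool) (x y : A) : ind b (x + y) = ind b x + ind b y := by
  cases b <;> simp [ind]

lemma ind_congr {b b' : Bool} {x : A} (h : b ≠ b' → x = 0) : ind b x = ind b' x := by
  by_cases e : b = b'
  · rw [e]
  · rw [h e]; cases b <;> cases b' <;> simp [ind]

lemma parts (n : ℕ) (e : ℕ → Bool) (x : ℕ → A) (h0 : x 0 = 0) (hn : x n = 0)
    (h : ∀ j, j + 1 < n → e j ≠ e (j + 1) → x (j + 1) = 0) :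
    ∑ j ∈ Finset.range n, ind (e j) (x j - x (j + 1)) = 0 := by
  have key : ∀ m, m < n → ∑ j ∈ Finset.range (m + 1), ind (e j) (x j - x (j + 1)) =
      - ind (e m) (x (m + 1)) := by
    intro m
    induction m with
    | zero => intro _; cases h : e 0 <;> simp [h0, ind, h]
    | succ m ih =>
      intro hm
      rw [Finset.sum_range_succ, ih (by omega), ind_congr (h m hm), ind_sub]; abel
  rcases n with _ | n
  · simp
  · rw [key n (by omega), hn]; simp [ind]

end comb

section core
variable {Y : Type*} [TopologicalSpace Y] {A : Type*} [AddCommGroup A]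

lemma core (th : (I → Y) → A) (U : Bool → Set Y) (w : Y)
    (hw : ∀ b, w ∈ U b)
    (hconst : ∀ y, th (fun _ => y) = 0)
    (hsq : ∀ F : I × I → Y, Continuous F → (∀ z b, F z ∈ U b) →
      th (fun u => F (u, 0)) + th (fun u => F (1, u)) = th (fun u => F (0, u)) + th (fun u => F (u, 1)))
    (f : ℝ → ℝ → ℝ → Y) (hf : Continuous fun z : ℝ × ℝ × ℝ => f z.1 z.2.1 z.2.2)
    (n m : ℕ) (hn : n = 2 * m) (hm : 0 < m)
    (hx : ∀ y z, f n y z = w)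
    (hy0 : ∀ x z, f x 0 z = w) (hy1 : ∀ x z, f x n z = w)
    (hz0 : ∀ x y, f x y 0 = w) (hz1 : ∀ x y, f x y n = w)
    (l : ℕ → ℕ → ℕ → Bool)
    (hl : ∀ k < n, ∀ i < n, ∀ j < n, ∀ u v r : I, f (k + u) (i + v) (j + r) ∈ U (l k i j))
    (hb0 : ∀ i < m, ∀ j < n, ∀ v r : I, f 0 (i + v) (j + r) ∈ U false)
    (hb1 : ∀ i, m ≤ i → i < n → ∀ j < n, ∀ v r : I, f 0 (i + v) (j + r) ∈ U true) :
    ∑ j ∈ Finset.range n, th (fun u => f 0 m (j + u)) = 0 := by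
  have hdiff : ∀ {b b' : Bool} {y : Y}, b ≠ b' → y ∈ U b → y ∈ U b' → ∀ c, y ∈ U c := by
    intro b b' y h h1 h2 c
    revert h1 h2 h
    cases b <;> cases b' <;> cases c <;> simp +contextual
  let a : ℕ → ℕ → ℕ → A := fun k i j => th (fun u => f k (i + u) j)
  let b : ℕ → ℕ → ℕ → A := fun k i j => th (fun u => f k i (j + u))
  let tr : ℕ → ℕ → ℕ → A := fun k i j => th (fun u => f (k + u) i j)
  let q : ℕ → ℕ → ℕ → A := fun k i j => (a k i j - a k i (j + 1)) - (b k i j - b k (i + 1) j)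
  -- horizontal squares
  have hq : ∀ k i j : ℕ, (∀ v r : I, ∀ c, f k (i + v) (j + r) ∈ U c) → q k i j = 0 := by
    intro k i j h
    have := hsq (fun z => f k (i + z.1) (j + z.2))
      (hf.comp (by fun_prop : Continuous fun z : I × I => ((k : ℝ), ((i : ℝ) + z.1), ((j : ℝ) + z.2))))
      (fun z c => h _ _ c)
    simp only [Set.Icc.coe_zero, Set.Icc.coe_one, add_zero] at this
    simp only [q, a, b]
    push_cast
    rw [← sub_eq_zero.2 this]; abel
  -- vertical squares
  let da : ℕ → ℕ → ℕ → A := fun k i j => a (k + 1) i j - a k i j - tr k (i + 1) j + tr k i j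
  let db : ℕ → ℕ → ℕ → A := fun k i j => b (k + 1) i j - b k i j - tr k i (j + 1) + tr k i j
  have hda : ∀ k i j : ℕ, (∀ u v : I, ∀ c, f (k + u) (i + v) j ∈ U c) → da k i j = 0 := by
    intro k i j h
    have := hsq (fun z => f (k + z.1) (i + z.2) j)
      (hf.comp (by fun_prop : Continuous fun z : I × I => (((k : ℝ) + z.1), ((i : ℝ) + z.2), (j : ℝ))))
      (fun z c => h _ _ c)
    simp only [Set.Icc.coe_zero, Set.Icc.coe_one, add_zero] at this
    simp only [da, a, tr]
    push_cast
    rw [← sub_eq_zero.2 this]; abel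
  have hdb : ∀ k i j : ℕ, (∀ u r : I, ∀ c, f (k + u) i (j + r) ∈ U c) → db k i j = 0 := by
    intro k i j h
    have := hsq (fun z => f (k + z.1) i (j + z.2))
      (hf.comp (by fun_prop : Continuous fun z : I × I => (((k : ℝ) + z.1), (i : ℝ), ((j : ℝ) + z.2))))
      (fun z c => h _ _ c)
    simp only [Set.Icc.coe_zero, Set.Icc.coe_one, add_zero] at this
    simp only [db, b, tr]
    push_cast
    rw [← sub_eq_zero.2 this]; abel
  let T : ℕ → ℕ → A := fun k lev =>
    ∑ i ∈ Finset.range n, ∑ j ∈ Finset.range n, ind (l k i j) (q lev i j)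
  have hT1 : ∀ k, k + 1 < n → T k (k + 1) = T (k + 1) (k + 1) := by
    intro k hk
    refine Finset.sum_congr rfl fun i hi => Finset.sum_congr rfl fun j hj => ind_congr fun hne => ?_
    rw [Finset.mem_range] at hi hj
    apply hq
    intro v r
    have h1 := hl k (by omega) i hi j hj 1 v r
    have h2 := hl (k + 1) hk i hi j hj 0 v r
    push_cast at h1 h2 ⊢
    rw [add_zero] at h2
    exact hdiff hne h1 h2
  have hT2 : ∀ k, k < n → T k k = T k (k + 1) := by
    intro k hk
    rw [eq_comm, ← sub_eq_zero]
    simp only [T, ← Finset.sum_sub_distrib, ← ind_sub]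
    have e : ∀ i j, q (k + 1) i j - q k i j = (da k i j - da k i (j + 1)) - (db k i j - db k (i + 1) j) := by
      intro i j
      simp only [q, da, db]; abel
    simp only [e, ind_sub _ (da k _ _ - _), Finset.sum_sub_distrib]
    have z1 : ∑ i ∈ Finset.range n, ∑ j ∈ Finset.range n, ind (l k i j) (da k i j - da k i (j + 1)) = 0 := by
      refine Finset.sum_eq_zero fun i hi => ?_
      rw [Finset.mem_range] at hi
      apply parts n (fun j => l k i j) (fun j => da k i j)
      · exact hda _ _ _ (fun u v c => by push_cast; rw [hz0]; exact hw c)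
      · exact hda _ _ _ (fun u v c => by rw [hz1]; exact hw c)
      · intro j hj hne
        refine hda _ _ _ (fun u v => ?_)
        have h1 := hl k hk i hi j (by omega) u v 1
        have h2 := hl k hk i hi (j + 1) hj u v 0
        push_cast at h1 h2 ⊢
        rw [add_zero] at h2
        exact hdiff hne h1 h2
    have z2 : ∑ i ∈ Finset.range n, ∑ j ∈ Finset.range n, ind (l k i j) (db k i j - db k (i + 1) j) = 0 := by
      rw [Finset.sum_comm]
      refine Finset.sum_eq_zero fun j hj => ?_
      rw [Finset.mem_range] at hj
      apply parts n (fun i => l k i j) (fun i => db k i j)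
      · exact hdb _ _ _ (fun u v c => by push_cast; rw [hy0]; exact hw c)
      · exact hdb _ _ _ (fun u v c => by rw [hy1]; exact hw c)
      · intro i hi hne
        refine hdb _ _ _ (fun u r => ?_)
        have h1 := hl k hk i (by omega) j hj u 1 r
        have h2 := hl k hk (i + 1) hi j hj u 0 r
        push_cast at h1 h2 ⊢
        rw [add_zero] at h2
        exact hdiff hne h1 h2
    rw [z1, z2, sub_zero]
  have hT3 : ∀ k, k < n → T 0 0 = T k (k + 1) := by
    intro k
    induction k with
    | zero => intro h; exact hT2 0 h
    | succ k ih => intro h; rw [ih (by omega), hT1 k h, hT2 _ h]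
  have hT4 : T 0 0 = 0 := by
    obtain ⟨n', rfl⟩ : ∃ n', n = n' + 1 := ⟨n - 1, by omega⟩
    rw [hT3 n' (by omega)]
    refine Finset.sum_eq_zero fun i hi => Finset.sum_eq_zero fun j hj => ?_
    rw [hq]
    · simp [ind]
    · intro v r c; rw [hx]; exact hw c
  let χ : ℕ → Bool := fun i => decide (m ≤ i)
  have hT5 : T 0 0 = ∑ i ∈ Finset.range n, ∑ j ∈ Finset.range n, ind (χ i) (q 0 i j) := by
    refine Finset.sum_congr rfl fun i hi => Finset.sum_congr rfl fun j hj => ind_congr fun hne => ?_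
    rw [Finset.mem_range] at hi hj
    apply hq
    intro v r
    have h1 := hl 0 (by omega) i hi j hj 0 v r
    push_cast at h1 ⊢
    rw [add_zero] at h1
    refine hdiff hne h1 ?_
    by_cases h : m ≤ i
    · have : χ i = true := by simp [χ, h]
      rw [this]; exact hb1 i h hi j hj v r
    · have : χ i = false := by simp [χ, h]
      rw [this]; exact hb0 i (by omega) j hj v r
  have ha0 : ∀ i, a 0 i 0 = 0 := by
    intro i; simp only [a, Nat.cast_zero, hz0]; exact hconst _
  have han : ∀ i, a 0 i n = 0 := by
    intro i; simp only [a, hz1]; exact hconst _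
  have hbn : ∀ j, b 0 n j = 0 := by
    intro j; simp only [b, hy1]; exact hconst _
  have hT6 : ∑ i ∈ Finset.range n, ∑ j ∈ Finset.range n, ind (χ i) (q 0 i j) =
      - ∑ j ∈ Finset.range n, b 0 m j := by
    simp only [q, ind_sub _ (a 0 _ _ - _), Finset.sum_sub_distrib]
    have z1 : ∑ i ∈ Finset.range n, ∑ j ∈ Finset.range n, ind (χ i) (a 0 i j - a 0 i (j + 1)) = 0 :=
      Finset.sum_eq_zero fun i hi => parts n (fun j => χ i) (fun j => a 0 i j) (ha0 i) (han i)
        (fun j _ h => absurd rfl h)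
    rw [z1, zero_sub, Finset.sum_comm]
    congr 1
    refine Finset.sum_congr rfl fun j hj => ?_
    rw [hn, two_mul, Finset.sum_range_add]
    have z2 : ∑ i ∈ Finset.range m, ind (χ i) (b 0 i j - b 0 (i + 1) j) = 0 := by
      refine Finset.sum_eq_zero fun i hi => ?_
      rw [Finset.mem_range] at hi
      have : χ i = false := by simp [χ]; omega
      rw [this]; rfl
    rw [z2, zero_add]
    have z3 : ∀ i, ind (χ (m + i)) (b 0 (m + i) j - b 0 (m + i + 1) j) =
        b 0 (m + i) j - b 0 (m + (i + 1)) j := by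
      intro i
      have : χ (m + i) = true := by simp [χ]
      rw [this]; rfl
    simp only [z3]
    rw [Finset.sum_range_sub' (fun i => b 0 (m + i) j), add_zero, ← two_mul, ← hn, hbn, sub_zero]
  have fin : ∑ j ∈ Finset.range n, b 0 m j = 0 := by
    rw [← neg_eq_zero, ← hT6, ← hT5, hT4]
  simpa [b] using fin

end core
end SuspPi

namespace SuspPi
namespace Cov
variable {Y : Type*} [TopologicalSpace Y] {w : Y} (C : Cov Y w)

/-- abelianized fundamental group, written additively -/
abbrev Ab : Type _ := Additive (Abelianization (FundamentalGroup C.W C.w'))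

/-- the class of a loop in the abelianization -/
noncomputable def cls (p : Path C.w' C.w') : C.Ab := Additive.ofMul (Abelianization.of (fg p))

lemma exists_base (z : C.W) : Nonempty (Path C.w' z) := by
  obtain ⟨p, hp⟩ := C.pc z.1 z.2
  exact ⟨(liftPath (D := C.W) p hp z.2 C.hw).symm⟩

/-- chosen path to a point -/
noncomputable def base (z : C.W) : Path C.w' z := (C.exists_base z).some

/-- class of a path in the intersection -/
noncomputable def thP {z z' : C.W} (c : Path z z') : C.Ab :=
  C.cls (((C.base z).trans c).trans (C.base z').symm)

lemma thP_congr {z z' : C.W} {c d : Path z z'} (h : c.Homotopic d) : C.thP c = C.thP d := by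
  unfold thP cls
  rw [fg_eq.2]
  exact ((Path.Homotopic.refl _).hcomp h).hcomp (Path.Homotopic.refl _)

lemma cls_trans (p q : Path C.w' C.w') : C.cls (p.trans q) = C.cls p + C.cls q := by
  unfold cls
  rw [fg_trans, map_mul, ofMul_mul, add_comm]

lemma cls_congr {p q : Path C.w' C.w'} (h : p.Homotopic q) : C.cls p = C.cls q := by
  unfold cls
  rw [fg_eq.2 h]

lemma thP_trans {z z' z'' : C.W} (c : Path z z') (d : Path z' z'') :
    C.thP (c.trans d) = C.thP c + C.thP d := by
  unfold thP
  rw [← cls_trans]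
  apply C.cls_congr
  apply Path.Homotopic.Quotient.eq.1
  simp only [Path.Homotopic.Quotient.mk_trans, Path.Homotopic.Quotient.mk_symm,
    Path.Homotopic.Quotient.trans_assoc]
  rw [← Path.Homotopic.Quotient.trans_assoc (Path.Homotopic.Quotient.symm _)
    (Path.Homotopic.Quotient.mk (C.base z')), Path.Homotopic.Quotient.symm_trans,
    Path.Homotopic.Quotient.refl_trans]

lemma cls_symm (p : Path C.w' C.w') : C.cls p.symm = - C.cls p := rfl

lemma thP_loop (p : Path C.w' C.w') : C.thP p = C.cls p := by
  unfold thP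
  rw [cls_trans, cls_trans, cls_symm]; abel

lemma thP_refl (z : C.W) : C.thP (Path.refl z) = 0 := by
  have := C.thP_trans (Path.refl z) (Path.refl z)
  rw [Path.refl_trans_refl] at this
  simpa using this

open Classical in
/-- class of an arbitrary function on the interval -/
noncomputable def th (c : I → Y) : C.Ab :=
  if h : Continuous c ∧ ∀ t, c t ∈ C.W then
    C.thP (⟨⟨fun t => (⟨c t, h.2 t⟩ : C.W), by have := h.1; fun_prop⟩, rfl, rfl⟩ :
      Path (⟨c 0, h.2 0⟩ : C.W) ⟨c 1, h.2 1⟩) else 0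

lemma thP_cast {z z' y y' : C.W} (p : Path z z') (h : y = z) (h' : y' = z') :
    C.thP (p.cast h h') = C.thP p := by
  subst h
  subst h'
  rfl

lemma th_eq {z z' : C.W} (p : Path z z') (c : I → Y) (h : ∀ t, c t = p t) :
    C.th c = C.thP p := by
  obtain rfl : c = fun t => (p t : Y) := funext h
  have hc : Continuous (fun t => (p t : Y)) ∧ ∀ t, (fun t => (p t : Y)) t ∈ C.W :=
    ⟨by fun_prop, fun t => (p t).2⟩
  unfold th
  rw [dif_pos hc, ← C.thP_cast p p.source p.target]
  congr 1

lemma th_const (y : Y) : C.th (fun _ => y) = 0 := by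
  by_cases h : y ∈ C.W
  · rw [C.th_eq (Path.refl (⟨y, h⟩ : C.W)) (fun _ => y) (fun _ => rfl), thP_refl]
  · unfold th
    rw [dif_neg]
    exact fun hc => h (hc.2 0)

lemma th_sq (F : I × I → Y) (hF : Continuous F) (h : ∀ z b, F z ∈ C.U b) :
    C.th (fun u => F (u, 0)) + C.th (fun u => F (1, u)) =
      C.th (fun u => F (0, u)) + C.th (fun u => F (u, 1)) := by
  let F' : I × I → C.W := fun z => ⟨F z, h z⟩
  have hF' : Continuous F' := by fun_prop
  let e1 : Path ((0 : I), (0 : I)) (1, 0) := ⟨⟨fun u => (u, 0), by fun_prop⟩, rfl, rfl⟩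
  let e2 : Path ((1 : I), (0 : I)) (1, 1) := ⟨⟨fun u => (1, u), by fun_prop⟩, rfl, rfl⟩
  let e3 : Path ((0 : I), (0 : I)) (0, 1) := ⟨⟨fun u => (0, u), by fun_prop⟩, rfl, rfl⟩
  let e4 : Path ((0 : I), (1 : I)) (1, 1) := ⟨⟨fun u => (u, 1), by fun_prop⟩, rfl, rfl⟩
  rw [C.th_eq (e1.map hF') (fun u => F (u, 0)) (fun _ => rfl), C.th_eq (e2.map hF') (fun u => F (1, u)) (fun _ => rfl),
    C.th_eq (e3.map hF') (fun u => F (0, u)) (fun _ => rfl), C.th_eq (e4.map hF') (fun u => F (u, 1)) (fun _ => rfl),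
    ← thP_trans, ← thP_trans, ← Path.map_trans, ← Path.map_trans]
  apply C.thP_congr
  have : ContractibleSpace I := (convex_Icc (0 : ℝ) 1).contractibleSpace ⟨0, by simp⟩
  exact (SimplyConnectedSpace.paths_homotopic (e1.trans e2) (e3.trans e4)).map ⟨F', hF'⟩

lemma th_subdiv (h : ℝ → Y) (hc : Continuous h) (hW : ∀ t, h t ∈ C.W) (n : ℕ) :
    ∑ j ∈ Finset.range n, C.th (fun u => h (j + u)) = C.th (fun u => h (n * u)) := by
  induction n with
  | zero => simp [th_const]
  | succ n ih =>
    rw [Finset.sum_range_succ, ih]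
    have := C.th_sq (fun z => h (n * z.1 + z.1 * z.2)) (by fun_prop) (fun z => hW _)
    simp only [Set.Icc.coe_zero, Set.Icc.coe_one, mul_zero, add_zero, mul_one, one_mul, zero_mul,
      th_const, zero_add] at this
    rw [this]
    congr 1
    funext u
    push_cast
    congr 1; ring

theorem cls_eq_zero (p : Path C.w' C.w') (hp : C.Phi (fg p) = 1) : C.cls p = 0 := by
  rw [Phi_fg, ← fg_refl] at hp
  obtain ⟨F⟩ := fg_eq.1 hp
  have hF : Continuous F := F.continuous
  set η := C.inc p with hη
  have hFc : Continuous fun z : I × I × I => F (z.1, z.2.1) z.2.2 :=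
    continuous_evalPath (fun z : I × I × I => F (z.1, z.2.1)) _ (by fun_prop) (by fun_prop)
  obtain ⟨N, hN⟩ := grid3 (fun b => {z | F (z.1, z.2.1) z.2.2 ∈ C.U b})
    (fun b => (C.opn b).preimage hFc) (fun z => C.cov _)
  let m := N + 1
  let n := 2 * m
  obtain ⟨l, hl⟩ := hN n (by omega)
  have hnR : (0 : ℝ) < n := by exact_mod_cast (by omega : 0 < n)
  let f : ℝ → ℝ → ℝ → Y := fun x y z => F (cl (x / n), cl (y / n)) (cl (z / n))
  have hcc : Continuous fun x : ℝ => cl (x / n) := continuous_cl.comp (by fun_prop)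
  have hf : Continuous fun z : ℝ × ℝ × ℝ => f z.1 z.2.1 z.2.2 :=
    hFc.comp ((hcc.comp continuous_fst).prodMk
      ((hcc.comp (continuous_fst.comp continuous_snd)).prodMk (hcc.comp (continuous_snd.comp continuous_snd))))
  have c1 : cl ((n : ℝ) / n) = 1 := cl_of_ge (by rw [div_self hnR.ne'])
  have c0 : cl ((0 : ℝ) / n) = 0 := cl_of_le (by simp)
  have hcell : ∀ (i : ℕ) (u : I), cl ((i + u) / n) ∈ Set.Icc (gp n i) (gp n (i + 1)) := by
    intro i u
    have h1 := u.2.1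
    have h2 := u.2.2
    exact ⟨Set.monotone_projIcc zero_le_one (by gcongr; linarith),
      Set.monotone_projIcc zero_le_one (by push_cast; gcongr)⟩
  have hsrc : ∀ x : I, F (x, 0) = ee w := fun x => by simp
  have htgt : ∀ x : I, F (x, 1) = ee w := fun x => by simp
  have hbot : ∀ y : I, F (0, y) = ((C.tau false η (fun t => C.inc_mem p t _)).trans
      (C.tau true η (fun t => C.inc_mem p t _)).symm) y := fun y => by simp; rfl
  have key := core C.th C.U w C.hw C.th_const C.th_sq f hf n m rfl (by omega)
    (by intro y z; simp only [f, c1]; simp)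
    (by intro x z; simp only [f, c0, hsrc]; rfl)
    (by intro x z; simp only [f, c1, htgt]; rfl)
    (by intro x y; simp only [f, c0]; simp)
    (by intro x y; simp only [f, c1]; simp)
    l
    (by
      intro k hk i hi j hj u v r
      exact hl k hk i hi j hj _ _ _ (hcell k u) (hcell i v) (hcell j r))
    (by
      intro i hi j hj v r
      have hv := (hcell i v).2
      simp only [f, c0, hbot]
      rw [Path.trans_apply, dif_pos]
      · exact C.tau_mem _ _ _ _ _
      · have : (cl ((i + v) / n) : ℝ) ≤ gp n (i + 1) := hv
        refine this.trans ?_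
        rw [coe_gp (by omega), div_le_iff₀ hnR]
        have : ((i + 1 : ℕ) : ℝ) ≤ m := by exact_mod_cast hi
        simp only [n]; push_cast at this ⊢; linarith)
    (by
      intro i hi hi2 j hj v r
      have hv := (hcell i v).1
      have : (gp n i : ℝ) ≤ cl ((i + v) / n) := hv
      rw [coe_gp (by omega), div_le_iff₀ hnR] at this
      have h3 : (m : ℝ) ≤ i := by exact_mod_cast hi
      have h4 : (1/2 : ℝ) ≤ cl ((i + v) / n) := by
        have hnm : (n : ℝ) = 2 * m := by simp [n]
        have hm0 : (0 : ℝ) < m := by exact_mod_cast (by omega : 0 < m)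
        rw [hnm] at this
        rw [hnm]
        by_contra hc
        push Not at hc
        nlinarith
      simp only [f, c0, hbot]
      rw [Path.trans_apply]
      split_ifs with h
      · have e : (cl ((i + v) / n) : ℝ) = 1/2 := le_antisymm h h4
        have : (⟨2 * (cl ((i + v) / n) : ℝ), (unitInterval.mul_pos_mem_iff zero_lt_two).2
            ⟨(cl ((i + v) / n)).2.1, h⟩⟩ : I) = 1 := by
          ext; simp [e]
        rw [this, Path.target]
        exact C.inc_mem p _ _
      · exact C.tau_mem _ _ _ _ _)
  have hmid : ∀ z : ℝ, f 0 m z = η (cl (z / n)) := by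
    intro z
    simp only [f, c0, hbot]
    have e : cl ((m : ℝ) / n) = ⟨1/2, by norm_num, by norm_num⟩ := by
      ext
      have : (m : ℝ) ≠ 0 := by exact_mod_cast (by omega : m ≠ 0)
      rw [coe_cl (by positivity)]
      · simp only [n]; push_cast; field_simp
      · rw [div_le_one hnR]; simp only [n]; push_cast; linarith
    rw [e, Path.trans_apply, dif_pos (by norm_num)]
    have : ∀ h, (⟨2 * (1/2 : ℝ), h⟩ : I) = 1 := by intro h; ext; norm_num
    simp only [this, Path.target]
  simp only [hmid] at key
  rw [C.th_subdiv (fun z => η (cl (z / n))) (by fun_prop) (fun t => C.inc_mem p _) n] at key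
  rw [← thP_loop, ← C.th_eq p _ (fun t => ?_), key]
  rw [mul_div_cancel_left₀ _ hnR.ne', cl_coe]
  rfl

/-- The abelianized fundamental group of the intersection is the fundamental group of loops. -/
noncomputable def abEquiv :
    Abelianization (FundamentalGroup C.W C.w') ≃* FundamentalGroup (Path w w) (ee w) := by
  letI : CommGroup (FundamentalGroup (Path w w) (ee w)) :=
    { (inferInstance : Group (FundamentalGroup (Path w w) (ee w))) with mul_comm := BB_comm }
  refine MulEquiv.ofBijective (Abelianization.lift C.Phi) ⟨?_, ?_⟩
  · rw [injective_iff_map_eq_one]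
    intro a
    obtain ⟨a, rfl⟩ := QuotientGroup.mk_surjective a
    obtain ⟨p, rfl⟩ := fg_surj a
    intro h
    exact C.cls_eq_zero p h
  · intro b
    obtain ⟨a, rfl⟩ := C.Phi_surjective b
    exact ⟨Abelianization.of a, rfl⟩

end Cov
end SuspPi

namespace SuspPi

/-- a homotopy equivalence induces an isomorphism of fundamental groups -/
noncomputable def heFG {X Z : Type} [TopologicalSpace X] [TopologicalSpace Z]
    (e : ContinuousMap.HomotopyEquiv X Z) (x : X) :
    FundamentalGroup X x ≃* FundamentalGroup Z (e.toFun x) :=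
  (Functor.FullyFaithful.ofFullyFaithful
    (FundamentalGroupoidFunctor.equivOfHomotopyEquiv e).functor).mulEquivEnd (FundamentalGroupoid.mk x)

section whisker
variable {Y : Type} [TopologicalSpace Y]

lemma continuous_path_trans {Z : Type*} [TopologicalSpace Z] {a b c : Y} (f : Z → Path a b)
    (g : Z → Path b c) (hf : Continuous f) (hg : Continuous g) :
    Continuous fun z => (f z).trans (g z) := by
  fun_prop

/-- reparametrisation as a map -/
def repMap {a b : Y} (f : I → I) (hf : Continuous f) (h0 : f 0 = 0) (h1 : f 1 = 1) :
    C(Path a b, Path a b) where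
  toFun p := p.reparam f hf h0 h1
  continuous_toFun := by
    apply continuous_toPath
    exact continuous_evalPath (fun z : Path a b × I => z.1) _ (by fun_prop) (by fun_prop)

lemma repMap_homotopic {a b : Y} (f : I → I) (hf : Continuous f) (h0 : f 0 = 0) (h1 : f 1 = 1) :
    (repMap (a := a) (b := b) f hf h0 h1).Homotopic (ContinuousMap.id _) := by
  have hc : Continuous fun z : I × I => Set.Icc.convexComb (f z.2) z.2 z.1 := by
    fun_prop
  refine ⟨⟨⟨fun z => z.2.reparam (fun t => Set.Icc.convexComb (f t) t z.1) (by fun_prop) (by simp [h0])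
    (by simp [h1]), ?_⟩, ?_, ?_⟩⟩
  · apply continuous_toPath
    exact continuous_evalPath (fun z : (I × Path a b) × I => z.1.2) _ (by fun_prop) (by fun_prop)
  · intro p; ext t; simp [repMap]
  · intro p; ext t; simp [repMap]

/-- whiskering -/
noncomputable def wh {a b c : Y} (δ : Path b c) : C(Path a b, Path a c) where
  toFun p := p.trans δ
  continuous_toFun := by fun_prop

lemma wh_homotopic {a b c : Y} {δ δ' : Path b c} (h : δ.Homotopic δ') :
    (wh (a := a) δ).Homotopic (wh δ') := by
  obtain ⟨F⟩ := h
  have hF : Continuous F.eval := by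
    apply continuous_toPath
    change Continuous fun z : I × I => F z
    fun_prop
  exact ⟨⟨⟨fun z => z.2.trans (F.eval z.1), by fun_prop⟩, fun p => by simp [wh], fun p => by simp [wh]⟩⟩

lemma wh_wh {a b c : Y} (δ : Path b c) :
    ((wh (a := a) δ.symm).comp (wh δ)).Homotopic (ContinuousMap.id _) := by
  have e1 : (wh (a := a) δ.symm).comp (wh δ) = (repMap
      (fun t => ⟨Path.Homotopy.transAssocReparamAux t, Path.Homotopy.transAssocReparamAux_mem_I t⟩)
      (by fun_prop)
      (Subtype.ext Path.Homotopy.transAssocReparamAux_zero)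
      (Subtype.ext Path.Homotopy.transAssocReparamAux_one)).comp (wh (δ.trans δ.symm)) := by
    ext1 p
    exact Path.Homotopy.trans_assoc_reparam p δ δ.symm
  have e2 : wh (a := a) (Path.refl b) = repMap
      (fun t => ⟨Path.Homotopy.transReflReparamAux t, Path.Homotopy.transReflReparamAux_mem_I t⟩)
      (by fun_prop)
      (Subtype.ext Path.Homotopy.transReflReparamAux_zero)
      (Subtype.ext Path.Homotopy.transReflReparamAux_one) := by
    ext1 p
    exact Path.Homotopy.trans_refl_reparam p
  rw [e1]
  refine ((repMap_homotopic _ _ _ _).comp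
    ((wh_homotopic ⟨(Path.Homotopy.reflTransSymm δ).symm⟩).trans (?_ : _ ))).trans
    (by rw [ContinuousMap.id_comp])
  rw [e2]
  exact repMap_homotopic _ _ _ _

/-- whiskering as a homotopy equivalence -/
noncomputable def whE {a b c : Y} (δ : Path b c) :
    ContinuousMap.HomotopyEquiv (Path a b) (Path a c) where
  toFun := wh δ
  invFun := wh δ.symm
  left_inv := wh_wh δ
  right_inv := by
    have := wh_wh (a := a) δ.symm
    rwa [Path.symm_symm] at this

/-- reversal -/
noncomputable def symE (a b : Y) : Path a b ≃ₜ Path b a where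
  toFun p := p.symm
  invFun p := p.symm
  left_inv p := p.symm_symm
  right_inv p := p.symm_symm
  continuous_toFun := Path.continuous_symm
  continuous_invFun := Path.continuous_symm

/-- a homotopy gives a path in the path space -/
lemma pathOfHomotopic {a b : Y} {p q : Path a b} (h : p.Homotopic q) : Nonempty (Path p q) := by
  obtain ⟨F⟩ := h
  refine ⟨⟨⟨F.eval, ?_⟩, by simp, by simp⟩⟩
  apply continuous_toPath
  change Continuous fun z : I × I => F z
  fun_prop

lemma base_change {y w : Y} (δ : Path y w) :
    Nonempty (FundamentalGroup (Path y y) (ee y) ≃* FundamentalGroup (Path w w) (ee w)) := by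
  have e1 := heFG (whE (a := y) δ) (ee y)
  have e2 := heFG (symE y w).toHomotopyEquiv ((ee y).trans δ)
  have e3 := heFG (whE (a := w) δ) ((ee y).trans δ).symm
  have hp : (((ee y).trans δ).symm.trans δ).Homotopic (ee w) := by
    apply Path.Homotopic.Quotient.eq.1
    simp only [ee, Path.Homotopic.Quotient.mk_trans, Path.Homotopic.Quotient.mk_symm,
      Path.Homotopic.Quotient.mk_refl, Path.Homotopic.Quotient.refl_trans,
      Path.Homotopic.Quotient.symm_trans]
  obtain ⟨P⟩ := pathOfHomotopic hp
  exact ⟨((e1.trans e2).trans e3).trans (FundamentalGroup.fundamentalGroupMulEquivOfPath P)⟩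

end whisker
end SuspPi

namespace SuspPi
section susp
variable {X : Type} [TopologicalSpace X]

/-- quotient map -/
def sq (p : X × I) : UnreducedSuspension X := Quotient.mk (suspSetoid X) p

lemma sq_quot : Topology.IsQuotientMap (sq : X × I → UnreducedSuspension X) :=
  isQuotientMap_quot_mk

lemma continuous_sq : Continuous (sq : X × I → UnreducedSuspension X) := sq_quot.continuous

lemma sq_eq {p p' : X × I} : sq p = sq p' ↔
    p = p' ∨ (p.2 = 0 ∧ p'.2 = 0) ∨ (p.2 = 1 ∧ p'.2 = 1) := Quotient.eq

/-- height -/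
def ht : UnreducedSuspension X → I := Quotient.lift Prod.snd (by
  rintro p p' (h | h | h)
  · rw [h]
  · rw [h.1, h.2]
  · rw [h.1, h.2])

lemma ht_sq (p : X × I) : ht (sq p) = p.2 := rfl

lemma continuous_ht : Continuous (ht : UnreducedSuspension X → I) :=
  continuous_snd.quotient_lift _

/-- representative -/
noncomputable def rp (y : UnreducedSuspension X) : X × I := (sq_quot.surjective y).choose

lemma sq_rp (y : UnreducedSuspension X) : sq (rp y) = y := (sq_quot.surjective y).choose_spec

lemma rp_sq (p : X × I) : rp (sq p) = p ∨ ((rp (sq p)).2 = 0 ∧ p.2 = 0) ∨ ((rp (sq p)).2 = 1 ∧ p.2 = 1) :=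
  sq_eq.1 (sq_rp (sq p))

lemma continuous_on_open {Z : Type*} [TopologicalSpace Z] (S : Set (UnreducedSuspension X))
    (hS : IsOpen S) (g : I × S → Z)
    (hg : Continuous fun z : I × (sq ⁻¹' S : Set (X × I)) => g (z.1, ⟨sq z.2.1, z.2.2⟩)) :
    Continuous g :=
  (sq_quot.restrictPreimage_isOpen hS).continuous_lift_prod_right hg

/-- other end -/
def en (b : Bool) : I := if b then 0 else 1

/-- the open sets -/
def SU (b : Bool) : Set (UnreducedSuspension X) := {y | ht y ≠ en b}

lemma SU_open (b : Bool) : IsOpen (SU b : Set (UnreducedSuspension X)) :=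
  isOpen_ne_fun continuous_ht continuous_const

lemma cc_ne (b : Bool) (h τ : I) (hh : h ≠ en b) : Set.Icc.convexComb h (en (!b)) τ ≠ en b := by
  intro e
  have e' := congrArg (Subtype.val) e
  apply hh
  apply Subtype.ext
  have a1 : (0 : ℝ) ≤ h := h.2.1
  have a2 : (h : ℝ) ≤ 1 := h.2.2
  have a3 : (0 : ℝ) ≤ τ := τ.2.1
  have a4 : (τ : ℝ) ≤ 1 := τ.2.2
  cases b
  · simp [en, Set.Icc.convexComb] at e'
    change (h : ℝ) = 1
    nlinarith [mul_nonneg a3 a1]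
  · simp [en, Set.Icc.convexComb] at e'
    change (h : ℝ) = 0
    nlinarith [mul_nonneg a3 (sub_nonneg.2 a2)]

lemma SU_con [Nonempty X] (b : Bool) : ContractibleSpace (SU b : Set (UnreducedSuspension X)) := by
  have x0 : X := Classical.arbitrary X
  have hmem : sq (x0, en (!b)) ∈ (SU b : Set (UnreducedSuspension X)) := by
    change en (!b) ≠ en b
    cases b <;> simp [en]
  have hne : ∀ y : (SU b : Set (UnreducedSuspension X)), (rp y.1).2 ≠ en b := by
    intro y
    have := y.2
    rw [← sq_rp y.1] at this
    exact this
  let g : I × (SU b : Set (UnreducedSuspension X)) → (SU b : Set (UnreducedSuspension X)) :=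
    fun z => ⟨sq ((rp z.2.1).1, Set.Icc.convexComb (rp z.2.1).2 (en (!b)) z.1),
      cc_ne b _ _ (hne z.2)⟩
  have hg : ∀ (τ : I) (p : X × I) (hp : sq p ∈ (SU b : Set (UnreducedSuspension X))),
      (g (τ, ⟨sq p, hp⟩) : UnreducedSuspension X) = sq (p.1, Set.Icc.convexComb p.2 (en (!b)) τ) := by
    intro τ p hp
    have hp' : p.2 ≠ en b := hp
    rcases rp_sq p with h | h | h
    · simp only [g, h]
    · simp only [g, h]
      have : b = false := by
        cases b
        · rfl
        · exact absurd h.2 hp'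
      subst this
      apply sq_eq.2
      right; left
      simp [en]
    · simp only [g, h]
      have : b = true := by
        cases b
        · exact absurd h.2 hp'
        · rfl
      subst this
      apply sq_eq.2
      right; right
      simp [en]
  have hgc : Continuous g := by
    apply continuous_on_open _ (SU_open b)
    rw [continuous_induced_rng]
    have : (Subtype.val ∘ fun z : I × (sq ⁻¹' (SU b) : Set (X × I)) => g (z.1, ⟨sq z.2.1, z.2.2⟩)) =
        fun z => sq (z.2.1.1, Set.Icc.convexComb z.2.1.2 (en (!b)) z.1) := by
      funext z
      exact hg _ _ _
    rw [this]
    apply continuous_sq.comp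
    fun_prop
  rw [contractible_iff_id_nullhomotopic]
  refine ⟨⟨_, hmem⟩, ⟨⟨⟨g, hgc⟩, ?_, ?_⟩⟩⟩
  · intro y
    ext
    simp [g, sq_rp]
  · intro y
    apply Subtype.ext
    simp only [g, ContinuousMap.coe_mk, ContinuousMap.const_apply]
    apply sq_eq.2
    cases b <;> simp [en]

/-- the cover of the suspension -/
noncomputable def hf : I := ⟨1/2, by norm_num, by norm_num⟩

lemma hf_ne (b : Bool) : hf ≠ en b := by
  intro h
  have := congrArg Subtype.val h
  cases b <;> norm_num [hf, en] at this

lemma cc_ne' (b : Bool) (h τ : I) (hh : h ≠ en b) : Set.Icc.convexComb h hf τ ≠ en b := by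
  intro e
  have e' := congrArg (Subtype.val) e
  apply hh
  apply Subtype.ext
  have a1 : (0 : ℝ) ≤ h := h.2.1
  have a2 : (h : ℝ) ≤ 1 := h.2.2
  have a3 : (0 : ℝ) ≤ τ := τ.2.1
  have a4 : (τ : ℝ) ≤ 1 := τ.2.2
  cases b
  · simp [en, hf, Set.Icc.convexComb] at e'
    change (h : ℝ) = 1
    have h0 : (τ : ℝ) = 0 := by nlinarith [mul_nonneg (sub_nonneg.2 a4) (sub_nonneg.2 a2)]
    rw [h0] at e'
    linarith
  · simp [en, hf, Set.Icc.convexComb] at e'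
    change (h : ℝ) = 0
    have h0 : (τ : ℝ) = 0 := by nlinarith [mul_nonneg (sub_nonneg.2 a4) a1]
    rw [h0] at e'
    linarith

/-- the path of heights -/
def hpath (h k : I) : Path h k :=
  ⟨⟨fun τ => Set.Icc.convexComb h k τ, by fun_prop⟩, by simp, by simp⟩

noncomputable def SC [PathConnectedSpace X] (x : X) : Cov (UnreducedSuspension X) (sq (x, hf)) where
  U := SU
  opn := SU_open
  cov y := by
    by_cases h : ht y = 0
    · exact ⟨false, by simp [SU, h, en]⟩
    · exact ⟨true, h⟩
  con b := by
    have : Nonempty X := ⟨x⟩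
    exact SU_con b
  hw b := hf_ne b
  pc y hy := by
    obtain ⟨⟨z, h⟩, rfl⟩ := sq_quot.surjective y
    let P1 : Path (sq (z, h)) (sq (z, hf)) := (hpath h hf).map (f := fun τ => sq (z, τ))
      (continuous_sq.comp (by fun_prop))
    let P2 : Path (sq (z, hf)) (sq (x, hf)) := (PathConnectedSpace.somePath z x).map
      (f := fun u => sq (u, hf)) (continuous_sq.comp (by fun_prop))
    refine ⟨P1.trans P2, ?_⟩
    exact Cov.trans_mem (fun τ b => cc_ne' b _ _ (hy b)) (fun τ b => hf_ne b)

lemma rp_mem (y : UnreducedSuspension X) (hy : ∀ b, y ∈ SU b) (p : X × I) (hp : sq p = y) : rp y = p := by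
  subst hp
  have h0 : p.2 ≠ 1 := hy false
  have h1 : p.2 ≠ 0 := hy true
  rcases rp_sq p with h | h | h
  · exact h
  · exact absurd h.2 h1
  · exact absurd h.2 h0

lemma W_open [PathConnectedSpace X] (x : X) : IsOpen (SC x).W := by
  have : (SC x).W = ⋂ b, SU b := by
    ext y
    rw [Set.mem_iInter]; rfl
  rw [this]
  exact isOpen_iInter_of_finite (fun b => SU_open b)

lemma rp_W [PathConnectedSpace X] (x : X) (p : X × I) (hp : sq p ∈ (SC x).W) : rp (sq p) = p :=
  rp_mem _ hp p rfl

lemma continuous_rp [PathConnectedSpace X] (x : X) :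
    Continuous fun y : (SC x).W => rp y.1 := by
  have : Continuous fun z : I × (SC x).W => rp z.2.1 := by
    apply continuous_on_open _ (W_open x)
    have e : (fun z : I × (sq ⁻¹' (SC x).W : Set (X × I)) => rp (sq z.2.1)) = fun z => z.2.1 := by
      funext z
      exact rp_W x _ z.2.2
    change Continuous (fun z : I × (sq ⁻¹' (SC x).W : Set (X × I)) => rp (sq z.2.1))
    rw [e]
    fun_prop
  exact this.comp (by fun_prop : Continuous fun y : (SC x).W => ((0 : I), y))

/-- the intersection is homotopy equivalent to the space -/
noncomputable def SWE [PathConnectedSpace X] (x : X) : ContinuousMap.HomotopyEquiv X (SC x).W where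
  toFun := ⟨fun z => ⟨sq (z, hf), fun b => hf_ne b⟩, by
    rw [continuous_induced_rng]
    exact continuous_sq.comp (by fun_prop : Continuous fun z : X => (z, hf))⟩
  invFun := ⟨fun y => (rp y.1).1, continuous_fst.comp (continuous_rp x)⟩
  left_inv := by
    have : ∀ f : C(X, X), f = ContinuousMap.id X → f.Homotopic (ContinuousMap.id X) := by
      rintro f rfl; exact ContinuousMap.Homotopic.refl _
    apply this
    ext z
    exact congrArg Prod.fst (rp_W x (z, hf) (fun b => hf_ne b))
  right_inv := by
    apply ContinuousMap.Homotopic.symm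
    refine ⟨⟨⟨fun z => ⟨sq ((rp z.2.1).1, Set.Icc.convexComb (rp z.2.1).2 hf z.1), ?_⟩, ?_⟩, ?_, ?_⟩⟩
    · intro b
      apply cc_ne'
      have := z.2.2 b
      rw [← sq_rp z.2.1] at this
      exact this
    · rw [continuous_induced_rng]
      have h1 := (continuous_rp x).comp (continuous_snd : Continuous fun z : I × (SC x).W => z.2)
      have h2 : Continuous fun z : I × (SC x).W => rp z.2.1 := h1
      refine continuous_sq.comp (f := fun z : I × (SC x).W =>
        ((rp z.2.1).1, Set.Icc.convexComb (rp z.2.1).2 hf z.1)) ?_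
      fun_prop
    · intro y
      apply Subtype.ext
      simp [sq_rp]
    · intro y
      apply Subtype.ext
      simp

lemma joined_susp [PathConnectedSpace X] (x : X) (y : UnreducedSuspension X) :
    Nonempty (Path y (sq (x, hf))) := by
  obtain ⟨⟨z, h⟩, rfl⟩ := sq_quot.surjective y
  let P1 : Path (sq (z, h)) (sq (z, hf)) := (hpath h hf).map (f := fun τ => sq (z, τ))
    (continuous_sq.comp (by fun_prop))
  let P2 : Path (sq (z, hf)) (sq (x, hf)) := (PathConnectedSpace.somePath z x).map
    (f := fun u => sq (u, hf)) (continuous_sq.comp (by fun_prop))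
  exact ⟨P1.trans P2⟩

theorem final [PathConnectedSpace X] (x : X) (y : UnreducedSuspension X) :
    Nonempty (HomotopyGroup (Fin 2) (UnreducedSuspension X) y ≃*
        Abelianization (FundamentalGroup X x)) := by
  obtain ⟨δ⟩ := joined_susp x y
  obtain ⟨e2⟩ := base_change δ
  have e1 := pi2Equiv y
  have e3 := (SC x).abEquiv
  have e4 : FundamentalGroup X x ≃* FundamentalGroup (SC x).W (SC x).w' := heFG (SWE x) x
  exact ⟨((e1.symm.trans e2).trans e3.symm).trans e4.symm.abelianizationCongr⟩

end susp
end SuspPi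

/-- If `X` is a nonempty path-connected topological space, then the second homotopy group of
the unreduced suspension `ΣX` (at any basepoint) is isomorphic to the abelianization of the
fundamental group of `X`. -/
theorem suspension_pi2_iso_abelianization_pi1 (X : Type) [TopologicalSpace X] [Nonempty X]
    [PathConnectedSpace X] (x : X) :
    ∀ y : UnreducedSuspension X,
      Nonempty (HomotopyGroup (Fin 2) (UnreducedSuspension X) y ≃*
        Abelianization (FundamentalGroup X x)) := by
  intro y
  exact SuspPi.final x y
end
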